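/- arXiv:0803.2576 — 13 statements merged into one kernel-verified Lean document; each statement's English description precedes it below -/
import Mathlib

section
/- For every λ with 0 < λ < λ̂ the equation θ = λ·(φ(θ) − 1) has exactly one root θ* in the open interval (0, θ₊). Moreover, for λ ≥ λ̂ (with λ̂ = 1/φ'(0)) no root exists in (0, θ₊) when λ·φ'(0) ≥ 1 forces λ(φ(θ)−1) > θ for all θ ∈ (0,θ₊). -/
open MeasureTheory Filter Set

open ProbabilityTheory

/-- The moment generating function of a random variable that is positive with positive
probability is strictly convex on every convex set where it is finite. -/
theorem strictConvexOn_mgf_of_pos {Ω : Type*} [MeasurableSpace Ω] {μ : Measure Ω}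
    {X : Ω → ℝ} {S : Set ℝ} (hX : 0 < μ {ω | 0 < X ω}) (hS : Convex ℝ S)
    (hSX : S ⊆ integrableExpSet X μ) : StrictConvexOn ℝ S (mgf X μ) := by
  refine ⟨hS, fun x hx y hy hxy a b ha hb hab => ?_⟩
  have hix : Integrable (fun ω => Real.exp (x * X ω)) μ := hSX hx
  have hiy : Integrable (fun ω => Real.exp (y * X ω)) μ := hSX hy
  have hiz : Integrable (fun ω => Real.exp ((a * x + b * y) * X ω)) μ :=
    hSX (hS hx hy ha.le hb.le hab)
  have hexp : ∀ ω, (a * x + b * y) * X ω = a • (x * X ω) + b • (y * X ω) := fun ω => by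
    simp only [smul_eq_mul]; ring
  have hisum : Integrable (fun ω => a * Real.exp (x * X ω) + b * Real.exp (y * X ω)) μ :=
    (hix.const_mul a).add (hiy.const_mul b)
  have hpos : 0 < ∫ ω, (a * Real.exp (x * X ω) + b * Real.exp (y * X ω)
      - Real.exp ((a * x + b * y) * X ω)) ∂μ := by
    rw [integral_pos_iff_support_of_nonneg]
    · refine hX.trans_le (measure_mono fun ω (hω : 0 < X ω) => ?_)
      have hne : x * X ω ≠ y * X ω := fun h => hxy (mul_right_cancel₀ hω.ne' h)
      have := strictConvexOn_exp.2 (mem_univ (x * X ω)) (mem_univ (y * X ω)) hne ha hb hab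
      rw [← hexp, smul_eq_mul, smul_eq_mul] at this
      exact (sub_pos.2 this).ne'
    · intro ω
      have := convexOn_exp.2 (mem_univ (x * X ω)) (mem_univ (y * X ω)) ha.le hb.le hab
      rw [← hexp, smul_eq_mul, smul_eq_mul] at this
      exact sub_nonneg.2 this
    · exact hisum.sub hiz
  rw [integral_sub hisum hiz,
    integral_add (hix.const_mul a) (hiy.const_mul b), integral_const_mul,
    integral_const_mul] at hpos
  simpa only [mgf, smul_eq_mul, sub_pos] using hpos

theorem one_add_mul_integral_lt_mgf {Ω : Type*} [MeasurableSpace Ω] {μ : Measure Ω}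
    [IsProbabilityMeasure μ] {X : Ω → ℝ} {t : ℝ} (hX : 0 < μ {ω | 0 < X ω})
    (hint : Integrable X μ) (ht : t ≠ 0) (hexp : Integrable (fun ω => Real.exp (t * X ω)) μ) :
    1 + t * ∫ ω, X ω ∂μ < mgf X μ t := by
  have hlin : Integrable (fun ω => t * X ω + 1) μ :=
    (hint.const_mul t).add (integrable_const 1)
  have hpos : 0 < ∫ ω, (Real.exp (t * X ω) - (t * X ω + 1)) ∂μ := by
    rw [integral_pos_iff_support_of_nonneg]
    · refine hX.trans_le (measure_mono fun ω (hω : 0 < X ω) => ?_)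
      exact (sub_pos.2 (Real.add_one_lt_exp (mul_ne_zero ht hω.ne'))).ne'
    · exact fun ω => sub_nonneg.2 (Real.add_one_le_exp _)
    · exact hexp.sub hlin
  rw [integral_sub hexp hlin, integral_add (hint.const_mul t) (integrable_const 1),
    integral_const_mul] at hpos
  simp only [integral_const, probReal_univ, smul_eq_mul, mul_one] at hpos
  rw [mgf]
  linarith

/-- If the moment generating function of a nonnegative random variable is finite everywhere, it
grows faster than any linear function. -/
theorem exists_lt_mul_mgf_sub_one {Ω : Type*} [MeasurableSpace Ω] {μ : Measure Ω}
    [IsProbabilityMeasure μ] {X : Ω → ℝ} (hX : 0 < μ {ω | 0 < X ω})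
    (hnn : ∀ᵐ ω ∂μ, 0 ≤ X ω)
    (hexp : ∀ t, Integrable (fun ω => Real.exp (t * X ω)) μ) {r : ℝ} (hr : 0 < r) :
    ∃ t, 0 < t ∧ t < r * (mgf X μ t - 1) := by
  have hsq : Integrable (fun ω => X ω ^ 2) μ :=
    integrable_pow_of_integrable_exp_mul one_ne_zero (hexp 1) (hexp (-1)) 2
  set c := ∫ ω, X ω ^ 2 ∂μ with hc_def
  have hc : 0 < c := by
    rw [hc_def, integral_pos_iff_support_of_nonneg (fun ω => sq_nonneg (X ω)) hsq]
    exact hX.trans_le (measure_mono fun ω (hω : 0 < X ω) => (pow_pos hω 2).ne')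
  have hle : ∀ t, 0 ≤ t → 1 + t ^ 2 / 2 * c ≤ mgf X μ t := by
    intro t ht
    have : ∫ ω, (1 + t ^ 2 / 2 * X ω ^ 2) ∂μ ≤ mgf X μ t := by
      refine integral_mono_ae ((integrable_const 1).add (hsq.const_mul _)) (hexp t) ?_
      filter_upwards [hnn] with ω hω
      have h0 : 0 ≤ t * X ω := mul_nonneg ht hω
      have := Real.quadratic_le_exp_of_nonneg h0
      nlinarith
    rw [integral_add (integrable_const 1) (hsq.const_mul _), integral_const_mul] at this
    simpa using this
  refine ⟨4 / (r * c), by positivity, ?_⟩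
  have h := hle (4 / (r * c)) (by positivity)
  have hpos : 0 < 4 / (r * c) := by positivity
  calc 4 / (r * c) < 2 * (4 / (r * c)) := by linarith
    _ = r * ((4 / (r * c)) ^ 2 / 2 * c) := by field_simp; norm_num
    _ ≤ r * (mgf X μ (4 / (r * c)) - 1) := by gcongr; linarith

theorem HasDerivAt.exists_lt_of_deriv_neg {f : ℝ → ℝ} {f' x b : ℝ} (hf : HasDerivAt f f' x)
    (hf' : f' < 0) (hb : x < b) : ∃ y, x < y ∧ y < b ∧ f y < f x := by
  have hslope : Tendsto (slope f x) (nhdsWithin x (Ioi x)) (nhds f') :=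
    hf.tendsto_slope.mono_left (nhdsWithin_mono x fun _ hy => ne_of_gt (mem_Ioi.1 hy))
  have hev := (hslope.eventually_lt_const hf').and (Ioo_mem_nhdsGT hb)
  obtain ⟨y, hy, hxy, hyb⟩ := hev.exists
  refine ⟨y, hxy, hyb, ?_⟩
  rw [slope_def_field, div_neg_iff] at hy
  rcases hy with ⟨-, h⟩ | ⟨h, -⟩ <;> linarith

/-- For every λ with 0 < λ < λ̂ the equation θ = λ·(φ(θ) − 1) has exactly
one root θ* in (0, θ₊); and for λ ≥ λ̂, λ·(φ(θ)−1) > θ for all θ ∈ (0,θ₊), so no root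
exists there. -/
theorem stmt_0
    {Ω : Type*} [MeasurableSpace Ω] (μ : Measure Ω) [IsProbabilityMeasure μ]
    (ξ : Ω → ℝ) (hmeas : Measurable ξ)
    (hnn : ∀ᵐ ω ∂μ, 0 ≤ ξ ω)
    (hint : Integrable ξ μ)
    (hmean : 0 < ∫ ω, ξ ω ∂μ)
    (hpp : 0 < μ {ω | 0 < ξ ω})
    (θp : EReal) (hθp : 0 < θp)
    (φ : ℝ → ℝ) (hφ : ∀ θ : ℝ, φ θ = ∫ ω, Real.exp (θ * ξ ω) ∂μ)
    (hfin : ∀ θ : ℝ, (θ : EReal) < θp →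
      Integrable (fun ω => Real.exp (θ * ξ ω)) μ)
    (hblow : ∀ t : ℝ, θp = (t : EReal) →
      Filter.Tendsto φ (nhdsWithin t (Set.Iio t)) Filter.atTop)
    (lamhat : ℝ) (hlamhat : lamhat = 1 / deriv φ 0) :
    (∀ lam : ℝ, 0 < lam → lam < lamhat →
      ∃! θ : ℝ, (0 < θ ∧ (θ : EReal) < θp) ∧ θ = lam * (φ θ - 1)) ∧
    (∀ lam : ℝ, lamhat ≤ lam →
      ∀ θ : ℝ, 0 < θ → (θ : EReal) < θp → θ < lam * (φ θ - 1)) := by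
  obtain rfl : φ = mgf ξ μ := funext hφ
  set S : Set ℝ := {θ : ℝ | (θ : EReal) < θp} with hS_def
  have hSopen : IsOpen S := isOpen_Iio.preimage continuous_coe_real_ereal
  have hSdown : ∀ x ∈ S, ∀ y ≤ x, y ∈ S := fun x hx y hyx =>
    (EReal.coe_le_coe_iff.2 hyx).trans_lt hx
  have hSord : S.OrdConnected := ⟨fun _ _ y hy z hz => hSdown y hy z hz.2⟩
  have hSsub : S ⊆ integrableExpSet ξ μ := fun θ hθ => hfin θ hθ
  have hSint : S ⊆ interior (integrableExpSet ξ μ) := interior_maximal hSsub hSopen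
  have h0S : (0 : ℝ) ∈ S := by simpa [hS_def] using hθp
  have hconv := strictConvexOn_mgf_of_pos hpp hSord.convex hSsub
  have hderiv : HasDerivAt (mgf ξ μ) (∫ ω, ξ ω ∂μ) 0 := by
    simpa using hasDerivAt_mgf (hSint h0S)
  rw [hderiv.deriv] at hlamhat
  set m := ∫ ω, ξ ω ∂μ with hm
  have hcont : ContinuousOn (mgf ξ μ) S := continuousOn_mgf.mono hSint
  refine ⟨fun lam hlam hlt => ?_, fun lam hle θ hθ hθS => ?_⟩
  · have hneg : lam * m - 1 < 0 := by
      rw [hlamhat, lt_div_iff₀ hmean] at hlt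
      linarith
    have hex : ∃ b, 0 < b ∧ b ∈ S ∧ b < lam * (mgf ξ μ b - 1) := by
      induction θp with
      | bot => simp at hθp
      | top =>
        obtain ⟨b, hb, hlt'⟩ :=
          exists_lt_mul_mgf_sub_one hpp hnn (fun t => hfin t (EReal.coe_lt_top t)) hlam
        exact ⟨b, hb, EReal.coe_lt_top b, hlt'⟩
      | coe t =>
        have ht : 0 < t := by exact_mod_cast hθp
        obtain ⟨b, hb, hb0, hbt⟩ := (((hblow t rfl).eventually_gt_atTop (t / lam + 1)).and
          (Ioo_mem_nhdsLT ht)).exists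
        refine ⟨b, hb0, EReal.coe_lt_coe_iff.2 hbt, ?_⟩
        have : t / lam < mgf ξ μ b - 1 := by linarith
        rw [div_lt_iff₀' hlam] at this
        exact hbt.trans this
    obtain ⟨b, hb0, hbS, hb⟩ := hex
    have hfd : HasDerivAt (fun θ => lam * (mgf ξ μ θ - 1) - θ) (lam * m - 1) 0 :=
      ((hderiv.sub_const 1).const_mul lam).sub (hasDerivAt_id 0)
    obtain ⟨a, ha0, hab, ha⟩ := hfd.exists_lt_of_deriv_neg hneg hb0
    simp only [mgf_zero, sub_self, mul_zero] at ha
    have hfc : ContinuousOn (fun θ => lam * (mgf ξ μ θ - 1) - θ) (Icc a b) :=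
      ((continuousOn_const.mul (hcont.sub continuousOn_const)).sub continuousOn_id).mono
        fun x hx => hSdown b hbS x hx.2
    obtain ⟨θ, hθ, hθ0⟩ := intermediate_value_Icc hab.le hfc
      (show (0 : ℝ) ∈ Icc _ _ from ⟨ha.le, (sub_pos.2 hb).le⟩)
    have hroots : ∀ x y : ℝ, 0 < x → x < y → y ∈ S → x = lam * (mgf ξ μ x - 1) →
        y ≠ lam * (mgf ξ μ y - 1) := by
      intro x y hx hxy hyS hxr hyr
      have h := hconv.secant_strict_mono h0S (hSdown y hyS x hxy.le) hyS hx.ne'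
        (hx.trans hxy).ne' hxy
      rw [mgf_zero, sub_zero, sub_zero, div_lt_div_iff₀ hx (hx.trans hxy)] at h
      have h' := mul_lt_mul_of_pos_left h hlam
      nlinarith
    refine ⟨θ, ⟨⟨ha0.trans_le hθ.1, hSdown b hbS θ hθ.2⟩, (sub_eq_zero.1 hθ0).symm⟩, ?_⟩
    rintro y ⟨⟨hy0, hyS⟩, hyr⟩
    have hθr : θ = lam * (mgf ξ μ θ - 1) := (sub_eq_zero.1 hθ0).symm
    rcases lt_trichotomy y θ with h | h | h
    · exact absurd hθr (hroots y θ hy0 h (hSdown b hbS θ hθ.2) hyr)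
    · exact h
    · exact absurd hyr (hroots θ y (ha0.trans_le hθ.1) h hyS hθr)
  · have hlt := one_add_mul_integral_lt_mgf hpp hint hθ.ne' (hfin θ hθS)
    rw [← hm] at hlt
    rw [hlamhat, div_le_iff₀ hmean] at hle
    have hlam : 0 < lam := pos_of_mul_pos_left (zero_lt_one.trans_le hle) hmean.le
    calc θ ≤ lam * m * θ := le_mul_of_one_le_left hθ.le hle
      _ = lam * (θ * m) := by ring
      _ < lam * (mgf ξ μ θ - 1) := by gcongr; linarith
end

section
/- For every integer l ≥ 1 and every λ with 0 < λ < ((l+1)/l)·λ̂, the equation (l+1)·θ = l·λ·(φ(θ) − 1) has exactly one root θ(λ,l) in the open interval (0, θ₊). -/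
open MeasureTheory Filter Set

/-- If the moment generating function is finite strictly below `T`, then every real number
strictly below `T` lies in the interior of its domain. -/
lemma mem_interior_integrableExpSet_of_coe_lt {Ω : Type*} [MeasurableSpace Ω] {μ : Measure Ω}
    {X : Ω → ℝ} {T : EReal}
    (hfin : ∀ t : ℝ, (t : EReal) < T → Integrable (fun ω => Real.exp (t * X ω)) μ)
    {t : ℝ} (ht : (t : EReal) < T) : t ∈ interior (ProbabilityTheory.integrableExpSet X μ) := by
  obtain ⟨c, htc, hcT⟩ := EReal.lt_iff_exists_real_btwn.1 ht
  refine mem_interior.2 ⟨Iio c, fun s hs => ?_, isOpen_Iio, EReal.coe_lt_coe_iff.1 htc⟩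
  exact hfin s ((EReal.coe_lt_coe_iff.2 hs).trans hcT)

/-- Jensen's inequality for the moment generating function. -/
lemma exp_mul_integral_le_mgf {Ω : Type*} [MeasurableSpace Ω] {μ : Measure Ω}
    [IsProbabilityMeasure μ] {X : Ω → ℝ} (hX : Integrable X μ) {t : ℝ}
    (ht : Integrable (fun ω => Real.exp (t * X ω)) μ) :
    Real.exp (t * ∫ ω, X ω ∂μ) ≤ ProbabilityTheory.mgf X μ t := by
  have h := convexOn_exp.map_integral_le (μ := μ) (f := fun ω => t * X ω)
    Real.continuous_exp.continuousOn isClosed_univ (by simp) (hX.const_mul t) ht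
  rwa [integral_const_mul] at h

/-- Strict convexity of the moment generating function of a random variable that is not almost
surely zero, along a segment starting at the origin. -/
lemma mgf_lt_of_pos_of_lt {Ω : Type*} [MeasurableSpace Ω] {μ : Measure Ω}
    [IsProbabilityMeasure μ] {X : Ω → ℝ} (hpos : μ {ω | 0 < X ω} ≠ 0) {a b : ℝ}
    (ha : 0 < a) (hab : a < b)
    (hia : Integrable (fun ω => Real.exp (a * X ω)) μ)
    (hib : Integrable (fun ω => Real.exp (b * X ω)) μ) :
    ProbabilityTheory.mgf X μ a < (1 - a / b) + a / b * ProbabilityTheory.mgf X μ b := by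
  have hb : 0 < b := ha.trans hab
  have hs0 : 0 < a / b := div_pos ha hb
  have hs1 : 0 < 1 - a / b := sub_pos.2 ((div_lt_one hb).2 hab)
  have hmul : ∀ x : ℝ, a / b * (b * x) = a * x := fun x => by field_simp
  have hle : ∀ ω, Real.exp (a * X ω) ≤ (1 - a / b) + a / b * Real.exp (b * X ω) := fun ω => by
    have h := convexOn_exp.2 (mem_univ 0) (mem_univ (b * X ω)) hs1.le hs0.le (by ring)
    simpa [hmul] using h
  have hlt : ∀ ω, 0 < X ω →
      Real.exp (a * X ω) < (1 - a / b) + a / b * Real.exp (b * X ω) := fun ω hω => by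
    have h := strictConvexOn_exp.2 (mem_univ 0) (mem_univ (b * X ω)) (mul_pos hb hω).ne hs1 hs0
      (by ring)
    simpa [hmul] using h
  have hirhs : Integrable (fun ω => (1 - a / b) + a / b * Real.exp (b * X ω)) μ :=
    (integrable_const _).add (hib.const_mul _)
  have hint : 0 < ∫ ω, ((1 - a / b) + a / b * Real.exp (b * X ω) - Real.exp (a * X ω)) ∂μ := by
    rw [integral_pos_iff_support_of_nonneg (fun ω => sub_nonneg.2 (hle ω)) (hirhs.sub hia)]
    exact (pos_iff_ne_zero.2 hpos).trans_le
      (measure_mono fun ω hω => (sub_pos.2 (hlt ω hω)).ne')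
  rw [integral_sub hirhs hia, integral_add (integrable_const _) (hib.const_mul _),
    integral_const_mul] at hint
  simpa [ProbabilityTheory.mgf] using hint

/-- For every integer l ≥ 1 and every λ with 0 < λ < ((l+1)/l)·λ̂, the
equation (l+1)·θ = l·λ·(φ(θ) − 1) has exactly one root θ(λ,l) in (0, θ₊). -/
theorem stmt_1
    {Ω : Type*} [MeasurableSpace Ω] (μ : Measure Ω) [IsProbabilityMeasure μ]
    (ξ : Ω → ℝ) (hmeas : Measurable ξ)
    (hnn : ∀ᵐ ω ∂μ, 0 ≤ ξ ω)
    (hint : Integrable ξ μ)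
    (hmean : 0 < ∫ ω, ξ ω ∂μ)
    (hpp : 0 < μ {ω | 0 < ξ ω})
    (θp : EReal) (hθp : 0 < θp)
    (φ : ℝ → ℝ) (hφ : ∀ θ : ℝ, φ θ = ∫ ω, Real.exp (θ * ξ ω) ∂μ)
    (hfin : ∀ θ : ℝ, (θ : EReal) < θp →
      Integrable (fun ω => Real.exp (θ * ξ ω)) μ)
    (hblow : ∀ t : ℝ, θp = (t : EReal) →
      Filter.Tendsto φ (nhdsWithin t (Set.Iio t)) Filter.atTop)
    (lamhat : ℝ) (hlamhat : lamhat = 1 / deriv φ 0)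
    (l : ℕ) (hl : 1 ≤ l) (lam : ℝ) (h0 : 0 < lam)
    (h1 : lam < ((l : ℝ) + 1) / (l : ℝ) * lamhat) :
    ∃! θ : ℝ, (0 < θ ∧ (θ : EReal) < θp) ∧
      ((l : ℝ) + 1) * θ = (l : ℝ) * lam * (φ θ - 1) := by
  obtain rfl : φ = ProbabilityTheory.mgf ξ μ := funext hφ
  have hI : ∀ {t : ℝ}, (t : EReal) < θp → t ∈ interior (ProbabilityTheory.integrableExpSet ξ μ) :=
    fun ht => mem_interior_integrableExpSet_of_coe_lt hfin ht
  have h0p : ((0 : ℝ) : EReal) < θp := by simpa using hθp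
  have hl0 : (0 : ℝ) < l := by exact_mod_cast hl
  have hc : 0 < (l : ℝ) * lam := mul_pos hl0 h0
  set m := ∫ ω, ξ ω ∂μ
  set f : ℝ → ℝ := fun t => l * lam * (ProbabilityTheory.mgf ξ μ t - 1) - (l + 1) * t with hf
  have hroot : ∀ t : ℝ, ((l : ℝ) + 1) * t = l * lam * (ProbabilityTheory.mgf ξ μ t - 1) ↔
      f t = 0 := fun t => by rw [hf, sub_eq_zero, eq_comm]
  have hf0 : f 0 = 0 := by simp [hf]
  have hcont : ∀ t : ℝ, (t : EReal) < θp → ContinuousAt f t := fun t ht =>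
    (((ProbabilityTheory.differentiableAt_mgf (hI ht)).continuousAt.sub
      continuousAt_const).const_mul _).sub (continuousAt_id.const_mul _)
  have hderiv0 : deriv (ProbabilityTheory.mgf ξ μ) 0 = m :=
    ProbabilityTheory.deriv_mgf_zero (hI h0p)
  have hslope : l * lam * m - (l + 1) < 0 := by
    rw [hlamhat, hderiv0, div_mul_div_comm, mul_one, lt_div_iff₀ (mul_pos hl0 hmean)] at h1
    linarith
  have hd : HasDerivAt f (l * lam * m - (l + 1)) 0 := by
    have h := (ProbabilityTheory.differentiableAt_mgf (hI h0p)).hasDerivAt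
    rw [hderiv0] at h
    have h2 := ((h.sub_const 1).const_mul ((l : ℝ) * lam)).sub
      ((hasDerivAt_id (0 : ℝ)).const_mul ((l : ℝ) + 1))
    rwa [mul_one] at h2
  have hneg : ∀ᶠ t in nhdsWithin (0 : ℝ) (Ioi 0), f t < 0 := by
    have h := (hasDerivWithinAt_iff_tendsto_slope' self_notMem_Ioi).1
      (hd.hasDerivWithinAt (s := Ioi 0))
    filter_upwards [h.eventually_lt_const hslope, self_mem_nhdsWithin] with t ht ht0
    rw [slope_def_field, hf0, sub_zero, sub_zero, div_neg_iff] at ht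
    rcases ht with ⟨-, h⟩ | ⟨h, -⟩
    · exact absurd h (not_lt.2 (le_of_lt ht0))
    · exact h
  obtain ⟨b, hb0, hbp, hfb⟩ : ∃ b : ℝ, 0 < b ∧ (b : EReal) < θp ∧ 0 < f b := by
    induction θp with
    | bot => simp at hθp
    | coe T =>
      have hT : 0 < T := EReal.coe_lt_coe_iff.1 h0p
      have h := (hblow T rfl).eventually_gt_atTop (1 + (l + 1) * T / (l * lam))
      obtain ⟨b, hb, hbI⟩ := (h.and (Ioo_mem_nhdsLT hT)).exists
      refine ⟨b, hbI.1, EReal.coe_lt_coe_iff.2 hbI.2, ?_⟩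
      have h2 : (l + 1) * T / (l * lam) < ProbabilityTheory.mgf ξ μ b - 1 := by linarith
      rw [div_lt_iff₀ hc] at h2
      have h3 : ((l : ℝ) + 1) * b < (l + 1) * T := mul_lt_mul_of_pos_left hbI.2 (by positivity)
      simp only [hf]
      linarith
    | top =>
      set b := 2 * ((l : ℝ) + 1) / (l * lam * m ^ 2) with hbdef
      have hb : 0 < b := by positivity
      refine ⟨b, hb, EReal.coe_lt_top b, ?_⟩
      have hJ := exp_mul_integral_le_mgf hint (hfin b (EReal.coe_lt_top b))
      have hq := Real.quadratic_le_exp_of_nonneg (mul_pos hb hmean).le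
      have h2 : b * m + (b * m) ^ 2 / 2 ≤ ProbabilityTheory.mgf ξ μ b - 1 := by linarith
      have h3 := mul_le_mul_of_nonneg_left h2 hc.le
      have h4 : l * lam * ((b * m) ^ 2 / 2) = (l + 1) * b := by
        have h5 : b * (l * lam * m ^ 2) = 2 * (l + 1) := by
          rw [hbdef]
          exact div_mul_cancel₀ _ (by positivity)
        linear_combination b / 2 * h5
      have h6 : 0 < l * lam * (b * m) := by positivity
      simp only [hf]
      linarith
  obtain ⟨a, hfa, ha⟩ := (hneg.and (Ioo_mem_nhdsGT hb0)).exists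
  obtain ⟨r, hr, hfr⟩ := intermediate_value_Icc ha.2.le
    (fun t ht => (hcont t ((EReal.coe_le_coe_iff.2 ht.2).trans_lt hbp)).continuousWithinAt)
    (show (0 : ℝ) ∈ Icc (f a) (f b) from ⟨hfa.le, hfb.le⟩)
  have hnot : ∀ s t : ℝ, 0 < s → s < t → (t : EReal) < θp → f s = 0 → f t ≠ 0 := by
    intro s t hs hst htp hfs hft
    have h := mgf_lt_of_pos_of_lt hpp.ne' hs hst
      (hfin s ((EReal.coe_lt_coe_iff.2 hst).trans htp)) (hfin t htp)
    have h2 := mul_lt_mul_of_pos_left h hc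
    have h3 : s / t * t = s := div_mul_cancel₀ _ (hs.trans hst).ne'
    simp only [hf] at hfs hft
    have h4 : s / t * (l * lam * (ProbabilityTheory.mgf ξ μ t - 1)) = (l + 1) * s := by
      linear_combination s / t * hft + (l + 1) * h3
    linarith
  refine ⟨r, ⟨⟨ha.1.trans_le hr.1, (EReal.coe_le_coe_iff.2 hr.2).trans_lt hbp⟩,
    (hroot r).2 hfr⟩, ?_⟩
  rintro t ⟨⟨ht0, htp⟩, ht⟩
  rw [hroot] at ht
  rcases lt_trichotomy t r with h | h | h
  · exact absurd hfr (hnot t r ht0 h ((EReal.coe_le_coe_iff.2 hr.2).trans_lt hbp) ht)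
  · exact h
  · exact absurd ht (hnot r t (ha.1.trans_le hr.1) h htp hfr)
end

section
/- The function λ ↦ θ*(λ) is strictly decreasing on the interval (0, λ̂): if 0 < λ₁ < λ₂ < λ̂ then θ*(λ₂) < θ*(λ₁). -/
open MeasureTheory Filter Set

/-- Secant inequality at the origin, by convexity of the exponential. -/
theorem integral_exp_smul_sub_one_le {Ω : Type*} [MeasurableSpace Ω] (μ : Measure Ω)
    [IsProbabilityMeasure μ] (ξ : Ω → ℝ) {s θ : ℝ} (hs₀ : 0 ≤ s) (hs₁ : s ≤ 1)
    (hθ : Integrable (fun ω => Real.exp (θ * ξ ω)) μ) :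
    ∫ ω, Real.exp (s * θ * ξ ω) ∂μ - 1 ≤ s * (∫ ω, Real.exp (θ * ξ ω) ∂μ - 1) := by
  have hle : ∫ ω, Real.exp (s * θ * ξ ω) ∂μ ≤ ∫ ω, ((1 - s) + s * Real.exp (θ * ξ ω)) ∂μ := by
    refine integral_mono_of_nonneg (.of_forall fun ω => (Real.exp_pos _).le)
      ((integrable_const _).add (hθ.const_mul s)) (.of_forall fun ω => ?_)
    have h := convexOn_exp.2 (mem_univ 0) (mem_univ (θ * ξ ω)) (sub_nonneg.2 hs₁) hs₀ (by ring)
    simpa [mul_assoc] using h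
  rw [integral_add (integrable_const _) (hθ.const_mul s), integral_const_mul] at hle
  simp only [integral_const, probReal_univ, one_smul] at hle
  linarith

/-- λ ↦ θ*(λ) is strictly decreasing on (0, λ̂). -/
theorem stmt_2
    {Ω : Type*} [MeasurableSpace Ω] (μ : Measure Ω) [IsProbabilityMeasure μ]
    (ξ : Ω → ℝ) (hmeas : Measurable ξ)
    (hnn : ∀ᵐ ω ∂μ, 0 ≤ ξ ω)
    (hint : Integrable ξ μ)
    (hmean : 0 < ∫ ω, ξ ω ∂μ)
    (hpp : 0 < μ {ω | 0 < ξ ω})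
    (θp : EReal) (hθp : 0 < θp)
    (φ : ℝ → ℝ) (hφ : ∀ θ : ℝ, φ θ = ∫ ω, Real.exp (θ * ξ ω) ∂μ)
    (hfin : ∀ θ : ℝ, (θ : EReal) < θp →
      Integrable (fun ω => Real.exp (θ * ξ ω)) μ)
    (hblow : ∀ t : ℝ, θp = (t : EReal) →
      Filter.Tendsto φ (nhdsWithin t (Set.Iio t)) Filter.atTop)
    (lamhat : ℝ) (hlamhat : lamhat = 1 / deriv φ 0)
    (θstar : ℝ → ℝ)
    (hθstar : ∀ lam : ℝ, 0 < lam → lam < lamhat →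
      (0 < θstar lam ∧ (θstar lam : EReal) < θp) ∧
        θstar lam = lam * (φ (θstar lam) - 1)) :
    ∀ lam1 lam2 : ℝ, 0 < lam1 → lam1 < lam2 → lam2 < lamhat →
      θstar lam2 < θstar lam1 := by
  intro lam1 lam2 h1 h12 h2
  obtain ⟨⟨hpos1, -⟩, heq1⟩ := hθstar lam1 h1 (h12.trans h2)
  obtain ⟨⟨hpos2, hlt2⟩, heq2⟩ := hθstar lam2 (h1.trans h12) h2
  by_contra! hle
  have hsecant := integral_exp_smul_sub_one_le μ ξ (div_pos hpos1 hpos2).le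
    ((div_le_one hpos2).2 hle) (hfin _ hlt2)
  rw [div_mul_cancel₀ _ hpos2.ne', ← hφ, ← hφ, div_mul_eq_mul_div, le_div_iff₀ hpos2] at hsecant
  have hgain : 0 < φ (θstar lam2) - 1 :=
    pos_of_mul_pos_right (heq2 ▸ hpos2) (h1.trans h12).le
  have hupper := mul_le_mul_of_nonneg_left hsecant h1.le
  rw [← mul_assoc, ← heq1, mul_left_comm] at hupper
  have hcancel := le_of_mul_le_mul_left hupper hpos1
  have hstrict := mul_lt_mul_of_pos_right h12 hgain
  linarith
end

section
/- (Optimization over the duration of overheating, case of l < k overheated flows.) Fix an integer l ≥ 1, d > 0 and 0 < λ < ((l+1)/l)·λ̂. Then λ·(l/(l+1))·φ'(θ(λ,l)) > 1, and the infimum over T > 0 of l·T·Λ*((l+1)·(d+T)/(l·T)) equals (l+1)·θ(λ,l)·d; moreover this infimum is attained at T(l) = d/(λ·(l/(l+1))·φ'(θ(λ,l)) − 1), and at the optimum the load rate equals b(l) = λ·(l/(l+1))·φ'(θ(λ,l)). -/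
open MeasureTheory Filter Set

open ProbabilityTheory

section

variable {Ω : Type*} [MeasurableSpace Ω] {μ : Measure Ω} {X : Ω → ℝ} {s t : ℝ}

/-- The moment generating function lies above its tangent lines. -/
theorem mgf_add_mul_le_mgf (hs : Integrable (fun ω => Real.exp (s * X ω)) μ)
    (hs' : Integrable (fun ω => X ω * Real.exp (s * X ω)) μ)
    (ht : Integrable (fun ω => Real.exp (t * X ω)) μ) :
    mgf X μ s + (t - s) * ∫ ω, X ω * Real.exp (s * X ω) ∂μ ≤ mgf X μ t := by
  rw [mgf, mgf, ← integral_const_mul, ← integral_add hs (hs'.const_mul _)]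
  refine integral_mono (hs.add (hs'.const_mul _)) ht fun ω => ?_
  have hexp : Real.exp (t * X ω) = Real.exp (s * X ω) * Real.exp ((t - s) * X ω) := by
    rw [← Real.exp_add]
    ring_nf
  simp only [hexp]
  nlinarith [Real.add_one_le_exp ((t - s) * X ω), Real.exp_pos (s * X ω)]

/-- The tangent line inequality at `s ≠ 0`, evaluated at `0`, is strict unless `X` vanishes
almost everywhere. -/
theorem mgf_sub_one_lt [IsProbabilityMeasure μ] (hX : 0 < μ {ω | 0 < X ω}) (hs0 : s ≠ 0)
    (hs : Integrable (fun ω => Real.exp (s * X ω)) μ)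
    (hs' : Integrable (fun ω => X ω * Real.exp (s * X ω)) μ) :
    mgf X μ s - 1 < s * ∫ ω, X ω * Real.exp (s * X ω) ∂μ := by
  have hs1 : Integrable (fun ω => Real.exp (s * X ω) - 1) μ := hs.sub (integrable_const _)
  have hgap : Integrable
      (fun ω => s * (X ω * Real.exp (s * X ω)) - (Real.exp (s * X ω) - 1)) μ :=
    (hs'.const_mul _).sub hs1
  have hfactor (x : ℝ) : s * (x * Real.exp (s * x)) - (Real.exp (s * x) - 1) =
      Real.exp (s * x) * (Real.exp (-(s * x)) - (-(s * x) + 1)) := by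
    have : Real.exp (s * x) * Real.exp (-(s * x)) = 1 := by
      rw [← Real.exp_add, add_neg_cancel, Real.exp_zero]
    linear_combination -this
  have hpos : 0 < ∫ ω, (s * (X ω * Real.exp (s * X ω)) - (Real.exp (s * X ω) - 1)) ∂μ := by
    rw [integral_pos_iff_support_of_nonneg _ hgap]
    · refine hX.trans_le (measure_mono fun ω hω => ?_)
      have hne : -(s * X ω) ≠ 0 := neg_ne_zero.2 (mul_ne_zero hs0 (ne_of_gt hω))
      rw [Function.mem_support, hfactor]
      exact (mul_pos (Real.exp_pos _) (sub_pos.2 (Real.add_one_lt_exp hne))).ne'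
    · intro ω
      simp only [hfactor]
      exact mul_nonneg (Real.exp_pos _).le (sub_nonneg.2 (Real.add_one_le_exp _))
  rw [integral_sub (hs'.const_mul _) hs1,
    integral_sub hs (integrable_const _), integral_const_mul] at hpos
  simp only [integral_const, probReal_univ, smul_eq_mul, mul_one] at hpos
  rw [mgf]
  linarith

/-- A quadratic lower bound on the moment generating function of a nonnegative random
variable. -/
theorem sq_div_two_mul_integral_sq_le_mgf (hX : ∀ᵐ ω ∂μ, 0 ≤ X ω)
    (hX2 : Integrable (fun ω => X ω ^ 2) μ) (ht0 : 0 ≤ t)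
    (ht : Integrable (fun ω => Real.exp (t * X ω)) μ) :
    t ^ 2 / 2 * ∫ ω, X ω ^ 2 ∂μ ≤ mgf X μ t := by
  rw [mgf, ← integral_const_mul]
  refine integral_mono_ae (hX2.const_mul _) ht ?_
  filter_upwards [hX] with ω hω
  have := Real.quadratic_le_exp_of_nonneg (mul_nonneg ht0 hω)
  nlinarith [mul_nonneg ht0 hω]

/-- If `X` is nonnegative, not almost everywhere zero and has exponential moments around `0`,
then the Legendre transform of `c * (mgf X μ - 1)` is finite at every `a ≥ 0`. -/
theorem bddAbove_mul_sub_mgf (hX : ∀ᵐ ω ∂μ, 0 ≤ X ω) (hX' : 0 < μ {ω | 0 < X ω})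
    (h0 : 0 ∈ interior (integrableExpSet X μ)) {S : Set ℝ} (hS : S ⊆ integrableExpSet X μ)
    {a c : ℝ} (ha : 0 ≤ a) (hc : 0 < c) :
    BddAbove {y : ℝ | ∃ t : ℝ, t ∈ S ∧ y = t * a - c * (mgf X μ t - 1)} := by
  have hX2 : Integrable (fun ω => X ω ^ 2) μ := integrable_pow_of_mem_interior_integrableExpSet h0 2
  have hm : 0 < ∫ ω, X ω ^ 2 ∂μ := by
    rw [integral_pos_iff_support_of_nonneg (fun ω => sq_nonneg _) hX2]
    refine hX'.trans_le (measure_mono fun ω hω => ?_)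
    exact pow_ne_zero 2 (ne_of_gt hω)
  set m := ∫ ω, X ω ^ 2 ∂μ
  refine ⟨a ^ 2 / (2 * (c * m)) + c, ?_⟩
  rintro _ ⟨t, ht, rfl⟩
  have hcm : 0 < c * m := mul_pos hc hm
  have hmgf : 0 ≤ c * mgf X μ t := mul_nonneg hc.le mgf_nonneg
  have hquad : 0 ≤ a ^ 2 / (2 * (c * m)) := by positivity
  rcases le_total t 0 with ht0 | ht0
  · nlinarith [mul_nonneg (neg_nonneg.2 ht0) ha]
  · have hlow := mul_le_mul_of_nonneg_left
      (sq_div_two_mul_integral_sq_le_mgf hX hX2 ht0 (hS ht)) hc.le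
    have hsq : t * a - t ^ 2 / 2 * (c * m) ≤ a ^ 2 / (2 * (c * m)) := by
      rw [le_div_iff₀ (by positivity)]
      nlinarith [sq_nonneg (t * (c * m) - a)]
    linarith

end

/-- optimization over the duration, l < k overheated flows. -/
theorem stmt_6
    {Ω : Type*} [MeasurableSpace Ω] (μ : Measure Ω) [IsProbabilityMeasure μ]
    (ξ : Ω → ℝ) (hmeas : Measurable ξ)
    (hnn : ∀ᵐ ω ∂μ, 0 ≤ ξ ω)
    (hint : Integrable ξ μ)
    (hmean : 0 < ∫ ω, ξ ω ∂μ)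
    (hpp : 0 < μ {ω | 0 < ξ ω})
    (θp : EReal) (hθp : 0 < θp)
    (φ : ℝ → ℝ) (hφ : ∀ θ : ℝ, φ θ = ∫ ω, Real.exp (θ * ξ ω) ∂μ)
    (hfin : ∀ θ : ℝ, (θ : EReal) < θp →
      Integrable (fun ω => Real.exp (θ * ξ ω)) μ)
    (hblow : ∀ t : ℝ, θp = (t : EReal) →
      Filter.Tendsto φ (nhdsWithin t (Set.Iio t)) Filter.atTop)
    (lamhat : ℝ) (hlamhat : lamhat = 1 / deriv φ 0)
    (l : ℕ) (hl : 1 ≤ l) (d : ℝ) (hd : 0 < d)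
    (lam : ℝ) (h0 : 0 < lam) (h1 : lam < ((l : ℝ) + 1) / (l : ℝ) * lamhat)
    (θl : ℝ) (hθl : (0 < θl ∧ (θl : EReal) < θp) ∧
      ((l : ℝ) + 1) * θl = (l : ℝ) * lam * (φ θl - 1))
    (Lam : ℝ → ℝ) (hLam : ∀ a : ℝ, Lam a =
      sSup {y : ℝ | ∃ θ : ℝ, (θ : EReal) < θp ∧ y = θ * a - lam * (φ θ - 1)})
    (Tl : ℝ) (hTl : Tl = d / (lam * ((l : ℝ) / ((l : ℝ) + 1)) * deriv φ θl - 1)) :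
    1 < lam * ((l : ℝ) / ((l : ℝ) + 1)) * deriv φ θl ∧
    IsGLB {y : ℝ | ∃ T : ℝ, 0 < T ∧
        y = (l : ℝ) * T * Lam (((l : ℝ) + 1) * (d + T) / ((l : ℝ) * T))}
      (((l : ℝ) + 1) * θl * d) ∧
    0 < Tl ∧
    (l : ℝ) * Tl * Lam (((l : ℝ) + 1) * (d + Tl) / ((l : ℝ) * Tl))
      = ((l : ℝ) + 1) * θl * d ∧
    (d + Tl) / Tl = lam * ((l : ℝ) / ((l : ℝ) + 1)) * deriv φ θl := by
  obtain rfl : φ = mgf ξ μ := funext hφ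
  obtain ⟨⟨hθ0, hθlt⟩, hroot⟩ := hθl
  have hsub : {θ : ℝ | (θ : EReal) < θp} ⊆ interior (integrableExpSet ξ μ) :=
    interior_maximal (fun θ hθ => hfin θ hθ)
      (isOpen_lt continuous_coe_real_ereal continuous_const)
  have hderiv : deriv (mgf ξ μ) θl = ∫ ω, ξ ω * Real.exp (θl * ξ ω) ∂μ := deriv_mgf (hsub hθlt)
  have hint' : Integrable (fun ω => ξ ω * Real.exp (θl * ξ ω)) μ := by
    simpa using integrable_pow_mul_exp_of_mem_interior_integrableExpSet (hsub hθlt) 1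
  have hl0 : (0 : ℝ) < l := by exact_mod_cast hl
  have hstrict := mgf_sub_one_lt hpp hθ0.ne' (hfin θl hθlt) hint'
  rw [← hderiv] at hstrict
  set D := deriv (mgf ξ μ) θl
  have hb : 1 < lam * ((l : ℝ) / ((l : ℝ) + 1)) * D := by
    have hlt : ((l : ℝ) + 1) * θl < l * lam * D * θl := by
      rw [hroot]
      nlinarith [mul_lt_mul_of_pos_left hstrict (mul_pos hl0 h0)]
    have hlt' : (l : ℝ) + 1 < l * lam * D := lt_of_mul_lt_mul_right hlt hθ0.le
    rw [show lam * ((l : ℝ) / ((l : ℝ) + 1)) * D = l * lam * D / (l + 1) by ring,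
      one_lt_div (by positivity)]
    exact hlt'
  have hTpos : 0 < Tl := hTl ▸ div_pos hd (sub_pos.2 hb)
  have hload : (d + Tl) / Tl = lam * ((l : ℝ) / ((l : ℝ) + 1)) * D := by
    have hne := (sub_pos.2 hb).ne'
    have hmul : Tl * (lam * ((l : ℝ) / ((l : ℝ) + 1)) * D - 1) = d := by
      rw [hTl, div_mul_cancel₀ _ hne]
    rw [div_eq_iff hTpos.ne']
    linarith
  have hvalue (T : ℝ) (hT : 0 < T) : (l : ℝ) * T *
      (θl * (((l : ℝ) + 1) * (d + T) / ((l : ℝ) * T)) - lam * (mgf ξ μ θl - 1)) =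
      ((l : ℝ) + 1) * θl * d := by
    have hcancel : (l : ℝ) * T * (((l : ℝ) + 1) * (d + T) / ((l : ℝ) * T)) =
        ((l : ℝ) + 1) * (d + T) := mul_div_cancel₀ _ (mul_pos hl0 hT).ne'
    linear_combination θl * hcancel + T * hroot
  have hopt : (l : ℝ) * Tl * Lam (((l : ℝ) + 1) * (d + Tl) / ((l : ℝ) * Tl)) =
      ((l : ℝ) + 1) * θl * d := by
    rw [← hvalue Tl hTpos, hLam]
    congr 1
    refine IsGreatest.csSup_eq ⟨⟨θl, hθlt, rfl⟩, ?_⟩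
    rintro _ ⟨θ, hθ, rfl⟩
    have hslope : ((l : ℝ) + 1) * (d + Tl) / ((l : ℝ) * Tl) = lam * D := by
      rw [mul_div_mul_comm, hload]
      field_simp
    have htan := mul_le_mul_of_nonneg_left
      (mgf_add_mul_le_mgf (hfin θl hθlt) hint' (hfin θ hθ)) h0.le
    rw [← hderiv] at htan
    rw [hslope]
    linarith
  refine ⟨hb, IsLeast.isGLB ⟨⟨Tl, hTpos, hopt.symm⟩, ?_⟩, hTpos, hopt, hload⟩
  rintro _ ⟨T, hT, rfl⟩
  rw [← hvalue T hT, hLam]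
  refine mul_le_mul_of_nonneg_left (le_csSup ?_ ⟨θl, hθlt, rfl⟩) (mul_pos hl0 hT).le
  exact bddAbove_mul_sub_mgf (S := {θ : ℝ | (θ : EReal) < θp}) hnn hpp (hsub hθp)
    (fun θ hθ => hfin θ hθ) (by positivity) h0
end

section
/- (Optimization over the duration of overheating, case of all k flows overheated.) Fix an integer k ≥ 1, d > 0 and 0 < λ < λ̂. Then λ·φ'(θ*(λ)) > 1, and the infimum over T > 0 of k·T·Λ*((d+T)/T) equals k·θ*(λ)·d; moreover this infimum is attained at T* = d/(λ·φ'(θ*(λ)) − 1), and at the optimum the load rate equals b* = λ·φ'(θ*(λ)). -/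
open MeasureTheory Filter Set

open ProbabilityTheory

/-- The tangent line at `s` lies below the moment generating function. -/
lemma mgf_tangent_le {Ω : Type*} [MeasurableSpace Ω] {μ : Measure Ω} {X : Ω → ℝ} {s t : ℝ}
    (hs : s ∈ interior (integrableExpSet X μ)) (ht : Integrable (fun ω => Real.exp (t * X ω)) μ) :
    mgf X μ s + (t - s) * deriv (mgf X μ) s ≤ mgf X μ t := by
  have hs' : Integrable (fun ω => Real.exp (s * X ω)) μ :=
    interior_subset (s := integrableExpSet X μ) hs
  have hXs : Integrable (fun ω => X ω * Real.exp (s * X ω)) μ := by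
    simpa using integrable_pow_mul_exp_of_mem_interior_integrableExpSet hs 1
  rw [deriv_mgf hs, ← integral_const_mul]
  unfold mgf
  rw [← integral_add hs' (hXs.const_mul _)]
  refine integral_mono (hs'.add (hXs.const_mul _)) ht fun ω => ?_
  have h := mul_le_mul_of_nonneg_left (Real.add_one_le_exp ((t - s) * X ω))
    (Real.exp_pos (s * X ω)).le
  rw [← Real.exp_add] at h
  ring_nf at h ⊢
  linarith

/-- The tangent line at `s > 0` is strictly below the moment generating function at `0` when the
variable does not vanish almost surely. -/
lemma mgf_sub_one_lt_mul_deriv {Ω : Type*} [MeasurableSpace Ω] {μ : Measure Ω}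
    [IsProbabilityMeasure μ] {X : Ω → ℝ} {s : ℝ} (hs0 : 0 < s)
    (hs : s ∈ interior (integrableExpSet X μ)) (hpos : 0 < μ {ω | 0 < X ω}) :
    mgf X μ s - 1 < s * deriv (mgf X μ) s := by
  have hs' : Integrable (fun ω => Real.exp (s * X ω)) μ :=
    interior_subset (s := integrableExpSet X μ) hs
  have hXs : Integrable (fun ω => X ω * Real.exp (s * X ω)) μ := by
    simpa using integrable_pow_mul_exp_of_mem_interior_integrableExpSet hs 1
  have key (y : ℝ) : Real.exp y * (Real.exp (-y) - (-y + 1)) = 1 - Real.exp y + y * Real.exp y := by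
    rw [mul_sub, ← Real.exp_add, add_neg_cancel, Real.exp_zero]
    ring
  have hi1 : Integrable (fun ω => 1 - Real.exp (s * X ω)) μ := (integrable_const 1).sub hs'
  have hi2 : Integrable (fun ω => s * (X ω * Real.exp (s * X ω))) μ := hXs.const_mul _
  have hi : Integrable
      (fun ω => 1 - Real.exp (s * X ω) + s * (X ω * Real.exp (s * X ω))) μ := hi1.add hi2
  have hI : 0 < ∫ ω, (1 - Real.exp (s * X ω) + s * (X ω * Real.exp (s * X ω))) ∂μ := by
    rw [integral_pos_iff_support_of_nonneg _ hi]
    · refine hpos.trans_le (measure_mono fun ω hω => ne_of_gt ?_)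
      have hy : 0 < s * X ω := mul_pos hs0 hω
      have h := mul_pos (Real.exp_pos (s * X ω))
        (sub_pos.2 (Real.add_one_lt_exp (neg_ne_zero.2 hy.ne')))
      rw [key] at h
      linarith
    · intro ω
      have h := mul_nonneg (Real.exp_pos (s * X ω)).le
        (sub_nonneg.2 (Real.add_one_le_exp (-(s * X ω))))
      rw [key] at h
      simp only [Pi.zero_apply]
      linarith
  rw [integral_add hi1 hi2, integral_sub (integrable_const 1) hs', integral_const_mul] at hI
  rw [deriv_mgf hs]
  simp only [integral_const, probReal_univ, one_smul] at hI
  unfold mgf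
  linarith

/-- The moment generating function of a nonnegative variable dominates the second order term of
its expansion. -/
lemma sq_mul_integral_sq_le_mgf {Ω : Type*} [MeasurableSpace Ω] {μ : Measure Ω} {X : Ω → ℝ}
    (hX : 0 ≤ᵐ[μ] X) (h0 : 0 ∈ interior (integrableExpSet X μ)) {t : ℝ} (ht0 : 0 ≤ t)
    (ht : Integrable (fun ω => Real.exp (t * X ω)) μ) :
    t ^ 2 / 2 * ∫ ω, X ω ^ 2 ∂μ ≤ mgf X μ t := by
  have hX2 : Integrable (fun ω => X ω ^ 2) μ := integrable_pow_of_mem_interior_integrableExpSet h0 2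
  rw [← integral_const_mul]
  refine integral_mono_ae (hX2.const_mul _) ht ?_
  filter_upwards [hX] with ω hω
  have hy : 0 ≤ t * X ω := mul_nonneg ht0 hω
  have h := Real.quadratic_le_exp_of_nonneg hy
  simp only [mul_pow] at h ⊢
  linarith

/-- optimization over the duration, all k flows overheated. -/
theorem stmt_7
    {Ω : Type*} [MeasurableSpace Ω] (μ : Measure Ω) [IsProbabilityMeasure μ]
    (ξ : Ω → ℝ) (hmeas : Measurable ξ)
    (hnn : ∀ᵐ ω ∂μ, 0 ≤ ξ ω)
    (hint : Integrable ξ μ)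
    (hmean : 0 < ∫ ω, ξ ω ∂μ)
    (hpp : 0 < μ {ω | 0 < ξ ω})
    (θp : EReal) (hθp : 0 < θp)
    (φ : ℝ → ℝ) (hφ : ∀ θ : ℝ, φ θ = ∫ ω, Real.exp (θ * ξ ω) ∂μ)
    (hfin : ∀ θ : ℝ, (θ : EReal) < θp →
      Integrable (fun ω => Real.exp (θ * ξ ω)) μ)
    (hblow : ∀ t : ℝ, θp = (t : EReal) →
      Filter.Tendsto φ (nhdsWithin t (Set.Iio t)) Filter.atTop)
    (lamhat : ℝ) (hlamhat : lamhat = 1 / deriv φ 0)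
    (k : ℕ) (hk : 1 ≤ k) (d : ℝ) (hd : 0 < d)
    (lam : ℝ) (h0 : 0 < lam) (h1 : lam < lamhat)
    (θs : ℝ) (hθs : (0 < θs ∧ (θs : EReal) < θp) ∧ θs = lam * (φ θs - 1))
    (Lam : ℝ → ℝ) (hLam : ∀ a : ℝ, Lam a =
      sSup {y : ℝ | ∃ θ : ℝ, (θ : EReal) < θp ∧ y = θ * a - lam * (φ θ - 1)})
    (Ts : ℝ) (hTs : Ts = d / (lam * deriv φ θs - 1)) :
    1 < lam * deriv φ θs ∧
    IsGLB {y : ℝ | ∃ T : ℝ, 0 < T ∧ y = (k : ℝ) * T * Lam ((d + T) / T)}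
      ((k : ℝ) * θs * d) ∧
    0 < Ts ∧
    (k : ℝ) * Ts * Lam ((d + Ts) / Ts) = (k : ℝ) * θs * d ∧
    (d + Ts) / Ts = lam * deriv φ θs := by
  obtain rfl : φ = mgf ξ μ := funext hφ
  obtain ⟨⟨hs0, hsp⟩, hroot⟩ := hθs
  have hsub : {θ : ℝ | (θ : EReal) < θp} ⊆ interior (integrableExpSet ξ μ) :=
    interior_maximal (fun θ hθ => hfin θ hθ)
      (isOpen_Iio.preimage continuous_coe_real_ereal)
  have hs_int : θs ∈ interior (integrableExpSet ξ μ) := hsub hsp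
  have h0_int : (0 : ℝ) ∈ interior (integrableExpSet ξ μ) := hsub (by simpa using hθp)
  have hb : 1 < lam * deriv (mgf ξ μ) θs := by
    have h := mul_lt_mul_of_pos_left (mgf_sub_one_lt_mul_deriv hs0 hs_int hpp) h0
    rw [← hroot] at h
    refine lt_of_mul_lt_mul_left (a := θs) ?_ hs0.le
    linarith
  set b := lam * deriv (mgf ξ μ) θs with hb_def
  have hb0 : 0 < b - 1 := sub_pos.2 hb
  have hTs0 : 0 < Ts := hTs ▸ div_pos hd hb0
  have hrate : (d + Ts) / Ts = b := by
    rw [hTs]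
    field_simp
    ring
  have hm2 : 0 < ∫ ω, ξ ω ^ 2 ∂μ := by
    have hX2 := integrable_pow_of_mem_interior_integrableExpSet h0_int 2
    rw [integral_pos_iff_support_of_nonneg (fun ω => sq_nonneg _) hX2]
    exact hpp.trans_le (measure_mono fun ω hω => pow_ne_zero 2 (ne_of_gt hω))
  set m := ∫ ω, ξ ω ^ 2 ∂μ
  have hbdd (a : ℝ) (ha : 0 < a) : BddAbove
      {y : ℝ | ∃ θ : ℝ, (θ : EReal) < θp ∧ y = θ * a - lam * (mgf ξ μ θ - 1)} := by
    refine ⟨lam + a ^ 2 / (2 * (lam * m)), ?_⟩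
    rintro y ⟨θ, hθ, rfl⟩
    have hlm : 0 < lam * m := mul_pos h0 hm2
    rcases le_total 0 θ with h | h
    · have h2 := mul_le_mul_of_nonneg_left
        (sq_mul_integral_sq_le_mgf hnn h0_int h (hfin θ hθ)) h0.le
      have h3 : θ * a - lam * (θ ^ 2 / 2 * m) ≤ a ^ 2 / (2 * (lam * m)) := by
        rw [le_div_iff₀ (by positivity)]
        nlinarith [sq_nonneg (a - lam * m * θ)]
      linarith
    · have h2 : 0 ≤ lam * mgf ξ μ θ := mul_nonneg h0.le mgf_nonneg
      have h3 : θ * a ≤ 0 := mul_nonpos_of_nonpos_of_nonneg h ha.le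
      have h4 : 0 ≤ a ^ 2 / (2 * (lam * m)) := by positivity
      linarith
  have hLam_ge (a : ℝ) (ha : 0 < a) : θs * a - θs ≤ Lam a := by
    rw [hLam]
    exact le_csSup (hbdd a ha) ⟨θs, hsp, by rw [← hroot]⟩
  have hLam_b : Lam b = θs * b - θs := by
    refine le_antisymm ?_ (hLam_ge b (by linarith))
    rw [hLam]
    refine csSup_le ⟨_, θs, hsp, rfl⟩ ?_
    rintro y ⟨θ, hθ, rfl⟩
    have h := mul_le_mul_of_nonneg_left (mgf_tangent_le hs_int (hfin θ hθ)) h0.le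
    have h' : lam * (mgf ξ μ θs + (θ - θs) * deriv (mgf ξ μ) θs)
        = lam * mgf ξ μ θs + (θ - θs) * b := by rw [hb_def]; ring
    rw [h'] at h
    linarith
  have hopt : (k : ℝ) * Ts * Lam ((d + Ts) / Ts) = (k : ℝ) * θs * d := by
    rw [hrate, hLam_b, hTs]
    field_simp
  refine ⟨hb, IsLeast.isGLB ⟨⟨Ts, hTs0, hopt.symm⟩, ?_⟩, hTs0, hopt, hrate⟩
  rintro y ⟨T, hT, rfl⟩
  calc (k : ℝ) * θs * d = (k : ℝ) * T * (θs * ((d + T) / T) - θs) := by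
        field_simp
        ring
    _ ≤ _ := mul_le_mul_of_nonneg_left (hLam_ge _ (by positivity)) (by positivity)
end

section
/- (Key equation of the proof of Lemma 2, part 1.) For all integers k ≥ 3 and l with 1 ≤ l ≤ k − 2, the equation l·(φ(ϑ/(l+1)) − 1) = k·(φ(ϑ/k) − 1) has exactly one solution ϑ*_{k,l} with 0 < ϑ*_{k,l} < (l+1)·θ₊; moreover the number λ*_{k,l} := ϑ*_{k,l} / (k·(φ(ϑ*_{k,l}/k) − 1)) satisfies 0 < λ*_{k,l} < λ̂. -/
open MeasureTheory Filter Set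

/-- A function with positive derivative on the positive half-line that is nonnegative at the origin
is positive on the positive half-line. -/
lemma pos_of_hasDerivAt_pos {f f' : ℝ → ℝ} (h0 : 0 ≤ f 0)
    (hf : ∀ x, HasDerivAt f (f' x) x) (hpos : ∀ x, 0 < x → 0 < f' x) {x : ℝ} (hx : 0 < x) :
    0 < f x := by
  have hmono : StrictMonoOn f (Ici 0) := by
    apply strictMonoOn_of_deriv_pos (convex_Ici 0)
    · exact fun y _ => (hf y).continuousAt.continuousWithinAt
    · intro y hy
      rw [interior_Ici] at hy
      rw [(hf y).deriv]
      exact hpos y hy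
  exact h0.trans_lt (hmono self_mem_Ici hx.le hx)

/-- The integrand whose expectation is the difference of the two sides of the key equation. -/
noncomputable def expGap (l k x : ℝ) : ℝ :=
  l * (Real.exp (x / (l + 1)) - 1) - k * (Real.exp (x / k) - 1)

lemma hasDerivAt_mul_exp_div (c s x : ℝ) :
    HasDerivAt (fun x => c * Real.exp (x / s)) (c / s * Real.exp (x / s)) x := by
  exact ((((hasDerivAt_id' x).div_const s).exp).const_mul c).congr_deriv (by ring)

lemma hasDerivAt_expGap {l k : ℝ} (hk : k ≠ 0) (x : ℝ) :
    HasDerivAt (expGap l k)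
      (l / (l + 1) * Real.exp (x / (l + 1)) - Real.exp (x / k)) x := by
  have h := ((hasDerivAt_mul_exp_div l (l + 1) x).sub_const l).sub
    ((hasDerivAt_mul_exp_div k k x).sub_const k)
  rw [div_self hk, one_mul] at h
  refine h.congr_of_eventuallyEq (Eventually.of_forall fun y => ?_)
  simp only [expGap, Pi.sub_apply]
  ring

lemma two_mul_expGap_lt {l k : ℝ} (hl : 1 ≤ l) (hk : l + 2 ≤ k) {x : ℝ} (hx : 0 < x) :
    2 * expGap l k x <
      x * (l / (l + 1) * Real.exp (x / (l + 1)) - Real.exp (x / k)) := by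
  have hk0 : 0 < k := by linarith
  have hcoef : 1 / k / k < l / (l + 1) / (l + 1) / (l + 1) := by
    rw [div_div, div_div, div_div, div_lt_div_iff₀ (by positivity) (by positivity)]
    nlinarith [mul_le_mul hk hk (by linarith) hk0.le]
  have hd0 : ∀ x : ℝ, HasDerivAt (fun x => l / (l + 1) * Real.exp (x / (l + 1)) - Real.exp (x / k))
      (l / (l + 1) / (l + 1) * Real.exp (x / (l + 1)) - 1 / k * Real.exp (x / k)) x := fun x => by
    simpa only [one_mul] using
      (hasDerivAt_mul_exp_div (l / (l + 1)) (l + 1) x).fun_sub (hasDerivAt_mul_exp_div 1 k x)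
  have hd1 : ∀ x : ℝ, HasDerivAt
      (fun x => x * (l / (l + 1) / (l + 1) * Real.exp (x / (l + 1)) - 1 / k * Real.exp (x / k)) -
        (l / (l + 1) * Real.exp (x / (l + 1)) - Real.exp (x / k)))
      (x * (l / (l + 1) / (l + 1) / (l + 1) * Real.exp (x / (l + 1)) -
        1 / k / k * Real.exp (x / k))) x := fun x => by
    exact (((hasDerivAt_id' x).fun_mul
      ((hasDerivAt_mul_exp_div (l / (l + 1) / (l + 1)) (l + 1) x).fun_sub
        (hasDerivAt_mul_exp_div (1 / k) k x))).fun_sub (hd0 x)).congr_deriv (by ring)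
  have hpos1 : ∀ x : ℝ, 0 < x →
      0 < x * (l / (l + 1) / (l + 1) * Real.exp (x / (l + 1)) - 1 / k * Real.exp (x / k)) -
        (l / (l + 1) * Real.exp (x / (l + 1)) - Real.exp (x / k)) := fun x hx => by
    refine pos_of_hasDerivAt_pos ?_ hd1 (fun y hy => ?_) hx
    · have : l / (l + 1) ≤ 1 := (div_le_one (by positivity)).2 (by linarith)
      simpa using this
    · refine mul_pos hy (sub_pos.2 ?_)
      have hexp : Real.exp (y / k) ≤ Real.exp (y / (l + 1)) := by
        gcongr
        linarith
      exact mul_lt_mul hcoef hexp (Real.exp_pos _) (by positivity)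
  have hd2 : ∀ x : ℝ, HasDerivAt
      (fun x => x * (l / (l + 1) * Real.exp (x / (l + 1)) - Real.exp (x / k)) -
        2 * expGap l k x)
      (x * (l / (l + 1) / (l + 1) * Real.exp (x / (l + 1)) - 1 / k * Real.exp (x / k)) -
        (l / (l + 1) * Real.exp (x / (l + 1)) - Real.exp (x / k))) x := fun x => by
    exact (((hasDerivAt_id' x).fun_mul (hd0 x)).fun_sub
      ((hasDerivAt_expGap (l := l) hk0.ne' x).const_mul 2)).congr_deriv (by ring)
  have := pos_of_hasDerivAt_pos (by simp [expGap]) hd2 hpos1 hx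
  linarith

lemma strictMonoOn_expGap_div_sq {l k : ℝ} (hl : 1 ≤ l) (hk : l + 2 ≤ k) :
    StrictMonoOn (fun x => expGap l k x / x ^ 2) (Ioi 0) := by
  have hk0 : k ≠ 0 := by linarith
  have hd : ∀ x : ℝ, 0 < x → HasDerivAt (fun x => expGap l k x / x ^ 2) _ x := fun x hx =>
    (hasDerivAt_expGap hk0 x).fun_div (hasDerivAt_pow 2 x) (by positivity)
  refine strictMonoOn_of_deriv_pos (convex_Ioi 0)
    (fun x hx => (hd x hx).continuousAt.continuousWithinAt) fun x hx => ?_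
  rw [interior_Ioi] at hx
  have hx0 : 0 < x := hx
  rw [(hd x hx).deriv]
  refine div_pos ?_ (by positivity)
  have := mul_lt_mul_of_pos_left (two_mul_expGap_lt hl hk hx0) hx0
  norm_num
  linarith

lemma sq_mul_expGap_lt {l k u v x : ℝ} (hl : 1 ≤ l) (hk : l + 2 ≤ k) (hu : 0 < u) (huv : u < v)
    (hx : 0 < x) : v ^ 2 * expGap l k (u * x) < u ^ 2 * expGap l k (v * x) := by
  have hv : 0 < v := hu.trans huv
  have h := strictMonoOn_expGap_div_sq hl hk (mul_pos hu hx) (mul_pos hv hx)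
    (mul_lt_mul_of_pos_right huv hx)
  simp only at h
  rw [div_lt_div_iff₀ (by positivity) (by positivity)] at h
  have hx2 : 0 < x ^ 2 := by positivity
  refine lt_of_mul_lt_mul_right ?_ hx2.le
  linarith

lemma exists_div_sub_le_expGap {l k : ℝ} (hl : 1 ≤ l) (hk : l + 2 ≤ k) :
    ∃ C, ∀ x, 0 ≤ x → x / k - C ≤ expGap l k x := by
  have hk0 : 0 < k := by linarith
  set d : ℝ := 1 / (l + 1) - 1 / k with hd
  have hd0 : 0 < d := sub_pos.2 (one_div_lt_one_div_of_lt (by linarith) (by linarith))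
  set X : ℝ := k / d with hX
  refine ⟨X / k + k * Real.exp (X / k), fun x hx => ?_⟩
  have hX0 : 0 < X := by positivity
  have hE : 0 < Real.exp (x / k) := Real.exp_pos _
  have hE1 := Real.add_one_le_exp (x / k)
  have hxk : 0 ≤ x / k := by positivity
  unfold expGap
  rcases le_total X x with h | h
  · have h1 : Real.exp (x / (l + 1)) = Real.exp (x / k) * Real.exp (x * d) := by
      rw [← Real.exp_add]; congr 1; rw [hd]; ring
    have h2 := Real.add_one_le_exp (x * d)
    have h3 : k ≤ x * d := (div_le_iff₀ hd0).1 h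
    have h4 : Real.exp (x / k) * (k + 1) ≤ Real.exp (x / (l + 1)) := by
      rw [h1]; gcongr; linarith
    have h5 : Real.exp (x / (l + 1)) - 1 ≤ l * (Real.exp (x / (l + 1)) - 1) := by
      have : 0 ≤ Real.exp (x / (l + 1)) - 1 := by
        have := Real.one_le_exp (x := x / (l + 1)) (by positivity)
        linarith
      nlinarith
    have h6 : 0 ≤ X / k + k * Real.exp (X / k) := by positivity
    nlinarith
  · have h1 : 0 ≤ l * (Real.exp (x / (l + 1)) - 1) := by
      have := Real.one_le_exp (x := x / (l + 1)) (by positivity)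
      exact mul_nonneg (by linarith) (by linarith)
    have h2 : k * Real.exp (x / k) ≤ k * Real.exp (X / k) := by gcongr
    have h3 : x / k ≤ X / k := by gcongr
    linarith

/-- Strict inequality of expectations from a strict inequality where the variable is positive. -/
lemma integral_comp_lt_integral_comp {Ω : Type*} [MeasurableSpace Ω] {μ : Measure Ω} {ξ : Ω → ℝ}
    (hnn : ∀ᵐ ω ∂μ, 0 ≤ ξ ω) (hpp : 0 < μ {ω | 0 < ξ ω}) {f g : ℝ → ℝ}
    (hf : Integrable (fun ω => f (ξ ω)) μ) (hg : Integrable (fun ω => g (ξ ω)) μ)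
    (h0 : f 0 = g 0) (hlt : ∀ x, 0 < x → f x < g x) :
    ∫ ω, f (ξ ω) ∂μ < ∫ ω, g (ξ ω) ∂μ := by
  rw [← sub_pos, ← integral_sub hg hf]
  refine (integral_pos_iff_support_of_nonneg_ae ?_ (hg.sub hf)).2 ?_
  rotate_left
  · exact hpp.trans_le (measure_mono fun ω hω => (sub_pos.2 (hlt _ hω)).ne')
  · filter_upwards [hnn] with ω hω
    rcases hω.eq_or_lt with h | h
    · simp [← h, h0]
    · exact sub_nonneg.2 (hlt _ h).le

lemma EReal.coe_lt_coe_mul_iff_div_lt {c : ℝ} (hc : 0 < c) (v : ℝ) (t : EReal) :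
    (v : EReal) < (c : EReal) * t ↔ ((v / c : ℝ) : EReal) < t := by
  induction t with
  | bot => simp [EReal.coe_mul_bot_of_pos hc]
  | top => simp [EReal.coe_mul_top_of_pos hc, EReal.coe_lt_top]
  | coe t =>
    rw [← EReal.coe_mul, EReal.coe_lt_coe_iff, EReal.coe_lt_coe_iff, div_lt_iff₀ hc, mul_comm]

theorem stmt_8
    {Ω : Type*} [MeasurableSpace Ω] (μ : Measure Ω) [IsProbabilityMeasure μ]
    (ξ : Ω → ℝ) (hmeas : Measurable ξ)
    (hnn : ∀ᵐ ω ∂μ, 0 ≤ ξ ω)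
    (hint : Integrable ξ μ)
    (hmean : 0 < ∫ ω, ξ ω ∂μ)
    (hpp : 0 < μ {ω | 0 < ξ ω})
    (θp : EReal) (hθp : 0 < θp)
    (φ : ℝ → ℝ) (hφ : ∀ θ : ℝ, φ θ = ∫ ω, Real.exp (θ * ξ ω) ∂μ)
    (hfin : ∀ θ : ℝ, (θ : EReal) < θp →
      Integrable (fun ω => Real.exp (θ * ξ ω)) μ)
    (hblow : ∀ t : ℝ, θp = (t : EReal) →
      Filter.Tendsto φ (nhdsWithin t (Set.Iio t)) Filter.atTop)
    (lamhat : ℝ) (hlamhat : lamhat = 1 / deriv φ 0)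
    (k l : ℕ) (hk : 3 ≤ k) (hl : 1 ≤ l) (hlk : l + 2 ≤ k) :
    (∃! v : ℝ, (0 < v ∧ (v : EReal) < (((l : ℝ) + 1 : ℝ) : EReal) * θp) ∧
      (l : ℝ) * (φ (v / ((l : ℝ) + 1)) - 1) = (k : ℝ) * (φ (v / (k : ℝ)) - 1)) ∧
    ∀ v : ℝ, ((0 < v ∧ (v : EReal) < (((l : ℝ) + 1 : ℝ) : EReal) * θp) ∧
      (l : ℝ) * (φ (v / ((l : ℝ) + 1)) - 1) = (k : ℝ) * (φ (v / (k : ℝ)) - 1)) →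
      0 < v / ((k : ℝ) * (φ (v / (k : ℝ)) - 1)) ∧
      v / ((k : ℝ) * (φ (v / (k : ℝ)) - 1)) < lamhat := by
  have hl' : (1 : ℝ) ≤ l := by exact_mod_cast hl
  have hlk' : (l : ℝ) + 2 ≤ k := by exact_mod_cast hlk
  generalize (l : ℝ) = L at *
  generalize (k : ℝ) = K at *
  have hK0 : 0 < K := by linarith
  have hL0 : 0 < L + 1 := by linarith
  simp only [EReal.coe_lt_coe_mul_iff_div_lt hL0]
  have hdivK : ∀ v : ℝ, 0 < v → ((v / (L + 1) : ℝ) : EReal) < θp →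
      ((v / K : ℝ) : EReal) < θp := fun v hv h => by
    refine lt_of_le_of_lt (EReal.coe_le_coe_iff.2 ?_) h
    gcongr
    linarith
  have hφmgf : φ = ProbabilityTheory.mgf ξ μ := funext hφ
  have hmem : ∀ θ : ℝ, (θ : EReal) < θp →
      θ ∈ interior (ProbabilityTheory.integrableExpSet ξ μ) := fun θ hθ => by
    obtain ⟨r, h1, h2⟩ := EReal.lt_iff_exists_real_btwn.1 hθ
    refine mem_interior.2 ⟨Iio r, fun s hs => hfin s ?_, isOpen_Iio, EReal.coe_lt_coe_iff.1 h1⟩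
    exact (EReal.coe_lt_coe_iff.2 hs).trans h2
  have hderiv : HasDerivAt φ (∫ ω, ξ ω ∂μ) 0 := by
    have := ProbabilityTheory.hasDerivAt_mgf (hmem 0 (by simpa using hθp))
    rw [hφmgf]
    simpa using this
  have hφ0 : φ 0 = 1 := by simp [hφ]
  have hcont : ∀ θ : ℝ, (θ : EReal) < θp → ContinuousAt φ θ := fun θ hθ => by
    rw [hφmgf]
    exact (ProbabilityTheory.hasDerivAt_mgf (hmem θ hθ)).continuousAt
  set D : ℝ → ℝ := fun v => L * (φ (v / (L + 1)) - 1) - K * (φ (v / K) - 1) with hD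
  have hintexp : ∀ v s : ℝ, ((v / s : ℝ) : EReal) < θp →
      Integrable (fun ω => Real.exp (v * ξ ω / s)) μ := fun v s h => by
    simpa only [mul_div_right_comm] using hfin _ h
  have hintgap : ∀ v : ℝ, 0 < v → ((v / (L + 1) : ℝ) : EReal) < θp →
      Integrable (fun ω => expGap L K (v * ξ ω)) μ := fun v hv h =>
    (((hintexp v _ h).sub (integrable_const 1)).const_mul L).sub
      (((hintexp v _ (hdivK v hv h)).sub (integrable_const 1)).const_mul K)
  have hDgap : ∀ v : ℝ, 0 < v → ((v / (L + 1) : ℝ) : EReal) < θp →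
      ∫ ω, expGap L K (v * ξ ω) ∂μ = D v := fun v hv h => by
    have h1 := hintexp v _ h
    have h2 := hintexp v _ (hdivK v hv h)
    unfold expGap
    have h3 : Integrable (fun ω => L * (Real.exp (v * ξ ω / (L + 1)) - 1)) μ :=
      (h1.sub (integrable_const 1)).const_mul L
    have h4 : Integrable (fun ω => K * (Real.exp (v * ξ ω / K) - 1)) μ :=
      (h2.sub (integrable_const 1)).const_mul K
    rw [integral_sub h3 h4, integral_const_mul, integral_const_mul,
      integral_sub h1 (integrable_const 1), integral_sub h2 (integrable_const 1)]
    simp [hD, hφ, mul_div_right_comm]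
  have hDcont : ∀ v : ℝ, 0 < v → ((v / (L + 1) : ℝ) : EReal) < θp → ContinuousAt D v :=
      fun v hv h => by
    have h1 : ContinuousAt (fun v => φ (v / (L + 1))) v :=
      ContinuousAt.comp' (f := fun v => v / (L + 1)) (hcont _ h) (by fun_prop)
    have h2 : ContinuousAt (fun v => φ (v / K)) v :=
      ContinuousAt.comp' (f := fun v => v / K) (hcont _ (hdivK v hv h)) (by fun_prop)
    exact ((h1.sub_const 1).const_mul L).sub ((h2.sub_const 1).const_mul K)
  have hDlt : ∀ u v : ℝ, 0 < u → u < v → ((v / (L + 1) : ℝ) : EReal) < θp →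
      v ^ 2 * D u < u ^ 2 * D v := fun u v hu huv h => by
    have hu' : ((u / (L + 1) : ℝ) : EReal) < θp := by
      refine lt_trans (EReal.coe_lt_coe_iff.2 ?_) h
      gcongr
    have hv := hu.trans huv
    rw [← hDgap u hu hu', ← hDgap v hv h, ← integral_const_mul, ← integral_const_mul]
    refine integral_comp_lt_integral_comp hnn hpp
      (f := fun x => v ^ 2 * expGap L K (u * x)) (g := fun x => u ^ 2 * expGap L K (v * x))
      ((hintgap u hu hu').const_mul _) ((hintgap v hv h).const_mul _) (by simp [expGap])
      fun x hx => sq_mul_expGap_lt hl' hlk' hu huv hx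
  have hneg : ∀ᶠ v in nhdsWithin (0 : ℝ) (Ioi 0), D v < 0 := by
    have hd : HasDerivAt D ((L / (L + 1) - 1) * ∫ ω, ξ ω ∂μ) 0 := by
      have h1 : ∀ s : ℝ, HasDerivAt (fun v => φ (v / s)) ((∫ ω, ξ ω ∂μ) * (1 / s)) 0 := fun s =>
        HasDerivAt.comp (h := fun v : ℝ => v / s) (0 : ℝ) (by simpa using hderiv)
          ((hasDerivAt_id' (0 : ℝ)).div_const s)
      refine ((((h1 (L + 1)).sub_const 1).const_mul L).fun_sub
        (((h1 K).sub_const 1).const_mul K)).congr_deriv ?_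
      field_simp
    have hc : (L / (L + 1) - 1) * ∫ ω, ξ ω ∂μ < 0 :=
      mul_neg_of_neg_of_pos (sub_neg.2 ((div_lt_one hL0).2 (by linarith))) hmean
    have hs := (hasDerivAt_iff_tendsto_slope.1 hd).mono_left
      (nhdsWithin_mono 0 (fun x (hx : 0 < x) => hx.ne'))
    filter_upwards [hs.eventually_lt_const hc, self_mem_nhdsWithin] with v hv hv0
    have hv0' : 0 < v := hv0
    have hD0 : D 0 = 0 := by simp [hD, hφ0]
    rw [slope_def_field, hD0, sub_zero, sub_zero, div_lt_iff₀ hv0'] at hv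
    simpa using hv
  have hpos : ∃ v : ℝ, 0 < v ∧ ((v / (L + 1) : ℝ) : EReal) < θp ∧ 0 < D v := by
    induction θp with
    | bot => simp at hθp
    | top =>
      obtain ⟨C, hC⟩ := exists_div_sub_le_expGap hl' hlk'
      set m := ∫ ω, ξ ω ∂μ with hm
      have hv : 0 < K * (|C| + 1) / m := by positivity
      refine ⟨K * (|C| + 1) / m, hv, EReal.coe_lt_top _, ?_⟩
      rw [← hDgap _ hv (EReal.coe_lt_top _)]
      have hi : Integrable (fun ω => K * (|C| + 1) / m * ξ ω / K - C) μ :=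
        ((hint.const_mul _).div_const _).sub (integrable_const C)
      have hle := integral_mono_ae hi (hintgap _ hv (EReal.coe_lt_top _)) (by
        filter_upwards [hnn] with ω hω
        exact hC _ (by positivity))
      refine lt_of_lt_of_le ?_ hle
      rw [integral_sub ((hint.const_mul _).div_const _) (integrable_const C), integral_div,
        integral_const_mul, ← hm]
      have : K * (|C| + 1) / m * m / K = |C| + 1 := by field_simp
      simp only [this, integral_const, probReal_univ, one_smul]
      linarith [le_abs_self C]
    | coe t =>
      have ht : 0 < t := by simpa using hθp
      have hct : ContinuousAt (fun s => φ (s * (L + 1) / K)) t := by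
        refine ContinuousAt.comp' (f := fun s => s * (L + 1) / K) (hcont _ ?_) (by fun_prop)
        rw [EReal.coe_lt_coe_iff, div_lt_iff₀ hK0]
        gcongr
        linarith
      have h1 : Tendsto (fun s => L * (φ s - 1) - K * (φ (s * (L + 1) / K) - 1))
          (nhdsWithin t (Iio t)) atTop := by
        simp only [sub_eq_add_neg]
        refine Tendsto.atTop_add (C := -(K * (φ (t * (L + 1) / K) + -1))) ?_ ?_
        · exact (tendsto_atTop_add_const_right _ _ (hblow t rfl)).const_mul_atTop (by linarith)
        · exact (((hct.tendsto.mono_left nhdsWithin_le_nhds).add_const (-1)).const_mul K).neg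
      obtain ⟨s, hs, hst, hs0⟩ := ((h1.eventually_gt_atTop 0).and
        ((eventually_mem_nhdsWithin (s := Iio t)).and
          (nhdsWithin_le_nhds (lt_mem_nhds ht)))).exists
      refine ⟨s * (L + 1), by positivity, ?_, ?_⟩
      · rw [mul_div_cancel_right₀ _ hL0.ne']
        exact EReal.coe_lt_coe_iff.2 hst
      · simpa only [hD, mul_div_cancel_right₀ _ hL0.ne'] using hs
  refine ⟨?_, ?_⟩
  · obtain ⟨b, hb0, hb, hDb⟩ := hpos
    obtain ⟨a, hDa, ha0, hab⟩ := (hneg.and (Ioo_mem_nhdsGT hb0)).exists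
    have hle : ∀ v, v ≤ b → ((v / (L + 1) : ℝ) : EReal) < θp := fun v hv => by
      refine lt_of_le_of_lt (EReal.coe_le_coe_iff.2 ?_) hb
      gcongr
    obtain ⟨v, ⟨hav, hvb⟩, hv⟩ := intermediate_value_Icc hab.le
      (fun v hv => (hDcont v (ha0.trans_le hv.1) (hle v hv.2)).continuousWithinAt)
      (⟨hDa.le, hDb.le⟩ : (0 : ℝ) ∈ Icc (D a) (D b))
    have hv0 : 0 < v := ha0.trans_le hav
    refine ⟨v, ⟨⟨hv0, hle v hvb⟩, sub_eq_zero.1 hv⟩, ?_⟩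
    rintro w ⟨⟨hw0, hw⟩, hDw⟩
    have hDw' : D w = 0 := sub_eq_zero.2 hDw
    rcases lt_trichotomy w v with h | h | h
    · simpa [hv, hDw'] using hDlt w v hw0 h (hle v hvb)
    · exact h
    · simpa [hv, hDw'] using hDlt v w hv0 h hw
  · rintro v ⟨⟨hv0, hv⟩, -⟩
    have hvK := hdivK v hv0 hv
    have hi : Integrable (fun ω => v / K * ξ ω + 1) μ :=
      (hint.const_mul _).add (integrable_const 1)
    have h1 := integral_comp_lt_integral_comp hnn hpp (f := fun x => v / K * x + 1)
      (g := fun x => Real.exp (v / K * x)) hi (hfin _ hvK) (by simp) fun x hx =>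
        Real.add_one_lt_exp (by positivity)
    rw [← hφ, integral_add (hint.const_mul _) (integrable_const 1), integral_const_mul] at h1
    simp only [integral_const, probReal_univ, one_smul] at h1
    have h2 : v * ∫ ω, ξ ω ∂μ < K * (φ (v / K) - 1) := by
      calc v * ∫ ω, ξ ω ∂μ = K * (v / K * ∫ ω, ξ ω ∂μ) := by field_simp
        _ < K * (φ (v / K) - 1) := by gcongr; linarith
    have h3 : 0 < K * (φ (v / K) - 1) := (mul_pos hv0 hmean).trans h2
    refine ⟨div_pos hv0 h3, ?_⟩
    rw [hlamhat, hderiv.deriv, div_lt_div_iff₀ h3 hmean, one_mul]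
    exact h2
end

section
/- (Lemma 2, part 1.) For all integers k ≥ 3 and l with 1 ≤ l ≤ k − 2 there exists λ*_{k,l} with 0 < λ*_{k,l} < λ̂ such that: for every λ with 0 < λ < λ*_{k,l} one has (l+1)·θ(λ,l) < k·θ*(λ) (i.e. J(λ,l) < J(λ,k)), and for every λ with λ*_{k,l} < λ < λ̂ one has (l+1)·θ(λ,l) > k·θ*(λ) (i.e. J(λ,l) > J(λ,k)). -/
open MeasureTheory Filter Set

section PowerSeries

variable {w : ℕ → ℝ}

lemma hasSum_pow_strictMono (hw : ∀ n, 0 < w n) {a b A B : ℝ} (ha : 0 < a) (hab : a < b)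
    (hA : HasSum (fun n => w n * a ^ n) A) (hB : HasSum (fun n => w n * b ^ n) B) : A < B := by
  refine hasSum_lt (i := 1) (fun n => ?_) ?_ hA hB
  · exact mul_le_mul_of_nonneg_left (pow_le_pow_left₀ ha.le hab.le n) (hw n).le
  · simpa using mul_lt_mul_of_pos_left hab (hw 1)

/-- A power series with positive coefficients is strictly log-convex in `log θ`: the ratio
`g (c θ) / g θ` is strictly increasing for `c > 1`. -/
lemma hasSum_pow_ratio_strictMono (hw : ∀ n, 0 < w n) {a b c A B A' B' : ℝ} (ha : 0 < a)
    (hab : a < b) (hc : 1 < c)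
    (hA : HasSum (fun n => w n * a ^ n) A) (hB : HasSum (fun n => w n * b ^ n) B)
    (hA' : HasSum (fun n => w n * (c * a) ^ n) A')
    (hB' : HasSum (fun n => w n * (c * b) ^ n) B') : A' * B < B' * A := by
  have hb : 0 < b := ha.trans hab
  have hc0 : 0 < c := one_pos.trans hc
  have nonneg : ∀ x : ℝ, 0 < x → 0 ≤ fun n => w n * x ^ n := fun x hx n =>
    mul_nonneg (hw n).le (pow_nonneg hx.le n)
  have h₁ := hA'.mul hB (hA'.summable.mul_of_nonneg hB.summable
    (nonneg _ (by positivity)) (nonneg _ hb))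
  have h₂ := hB'.mul hA (hB'.summable.mul_of_nonneg hA.summable
    (nonneg _ (by positivity)) (nonneg _ ha))
  have h₁s := (Equiv.prodComm ℕ ℕ).hasSum_iff.mpr h₁
  have h₂s := (Equiv.prodComm ℕ ℕ).hasSum_iff.mpr h₂
  have key : ∀ i j : ℕ,
      (w i * (c * b) ^ i * (w j * a ^ j) + w j * (c * b) ^ j * (w i * a ^ i))
        - (w i * (c * a) ^ i * (w j * b ^ j) + w j * (c * a) ^ j * (w i * b ^ i))
      = w i * w j * ((c ^ i - c ^ j) * (b ^ i * a ^ j - a ^ i * b ^ j)) := by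
    intro i j
    simp only [mul_pow]
    ring
  have ordered : ∀ i j : ℕ, j ≤ i →
      0 ≤ (c ^ i - c ^ j) * (b ^ i * a ^ j - a ^ i * b ^ j) := by
    intro i j hij
    obtain ⟨d, rfl⟩ := Nat.exists_eq_add_of_le hij
    have hpow : a ^ d ≤ b ^ d := pow_le_pow_left₀ ha.le hab.le d
    have hcp : c ^ j ≤ c ^ (j + d) := pow_le_pow_right₀ hc.le (by omega)
    have : b ^ (j + d) * a ^ j - a ^ (j + d) * b ^ j = a ^ j * b ^ j * (b ^ d - a ^ d) := by
      ring
    rw [this]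
    exact mul_nonneg (sub_nonneg.2 hcp) (mul_nonneg (by positivity) (sub_nonneg.2 hpow))
  have hlt : A' * B + A' * B < B' * A + B' * A := by
    refine hasSum_lt (i := ((1, 0) : ℕ × ℕ)) ?_ ?_ (h₁.add h₁s) (h₂.add h₂s)
    · rintro ⟨i, j⟩
      have hij : 0 ≤ (c ^ i - c ^ j) * (b ^ i * a ^ j - a ^ i * b ^ j) := by
        rcases le_total j i with h | h
        · exact ordered i j h
        · have := ordered j i h
          nlinarith
      have := mul_nonneg (mul_pos (hw i) (hw j)).le hij
      rw [← key] at this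
      simpa using this
    · have : 0 < w 1 * w 0 * ((c ^ 1 - c ^ 0) * (b ^ 1 * a ^ 0 - a ^ 1 * b ^ 0)) := by
        refine mul_pos (mul_pos (hw 1) (hw 0)) ?_
        simpa using mul_pos (sub_pos.2 hc) (sub_pos.2 hab)
      rw [← key] at this
      simpa using this
  linarith

lemma exists_mul_lt_of_hasSum_pow (hw : ∀ n, 0 < w n) {g : ℝ → ℝ}
    (hg : ∀ θ, 0 < θ → HasSum (fun n => w n * θ ^ n) (g θ)) {c r : ℝ} (hc : 1 < c)
    (hr : 0 < r) : ∃ θ, 0 < θ ∧ r * g θ < g (c * θ) := by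
  by_contra! H
  have hc0 : 0 < c := one_pos.trans hc
  have bound : ∀ j : ℕ, g (c ^ j) ≤ r ^ j * g 1 := by
    intro j
    induction j with
    | zero => simp
    | succ j ih =>
      calc g (c ^ (j + 1)) = g (c * c ^ j) := by rw [pow_succ']
        _ ≤ r * g (c ^ j) := H _ (by positivity)
        _ ≤ r * (r ^ j * g 1) := mul_le_mul_of_nonneg_left ih hr.le
        _ = r ^ (j + 1) * g 1 := by ring
  obtain ⟨N, hN⟩ := pow_unbounded_of_one_lt r hc
  obtain ⟨j, hj⟩ := pow_unbounded_of_one_lt (g 1 / w N) ((one_lt_div hr).2 hN)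
  have hterm : w N * (c ^ j) ^ N ≤ g (c ^ j) :=
    le_hasSum (hg (c ^ j) (by positivity)) N
      fun n _ => mul_nonneg (hw n).le (by positivity)
  rw [div_lt_iff₀ (hw N), div_pow, div_mul_eq_mul_div, lt_div_iff₀ (by positivity)] at hj
  have : (c ^ j) ^ N = (c ^ N) ^ j := by rw [← pow_mul, ← pow_mul, mul_comm]
  rw [this] at hterm
  linarith [bound j]

end PowerSeries

section Crossing

variable {w : ℕ → ℝ} {g : ℝ → ℝ} {θp : EReal}

lemma coe_lt_of_coe_mul_lt {c θ : ℝ} (hc : 1 < c) (hθ : 0 < θ) (h : ((c * θ : ℝ) : EReal) < θp) :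
    (θ : EReal) < θp :=
  lt_of_lt_of_le (EReal.coe_lt_coe_iff.2 (by nlinarith)) h.le

lemma exists_mul_lt_of_blowup (hw : ∀ n, 0 < w n) (hθp : 0 < θp)
    (hg : ∀ θ : ℝ, 0 < θ → (θ : EReal) < θp → HasSum (fun n => w n * θ ^ n) (g θ))
    (hblow : ∀ t : ℝ, θp = (t : EReal) → Tendsto g (nhdsWithin t (Iio t)) atTop)
    {c r : ℝ} (hc : 1 < c) (hr : 0 < r) :
    ∃ θ, 0 < θ ∧ ((c * θ : ℝ) : EReal) < θp ∧ r * g θ < g (c * θ) := by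
  have hc0 : 0 < c := one_pos.trans hc
  induction θp using EReal.rec with
  | bot => exact absurd hθp (by simp)
  | top =>
    obtain ⟨θ, hθ, h⟩ := exists_mul_lt_of_hasSum_pow hw
      (fun θ hθ => hg θ hθ (EReal.coe_lt_top θ)) hc hr
    exact ⟨θ, hθ, EReal.coe_lt_top _, h⟩
  | coe t =>
    have ht : 0 < t := by exact_mod_cast hθp
    have htc : t / c < t := div_lt_self ht hc
    have h₁ := (hblow t rfl).eventually_gt_atTop (r * g (t / c))
    have h₂ : ∀ᶠ s in nhdsWithin t (Iio t), s ∈ Ioo 0 t := Ioo_mem_nhdsLT ht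
    obtain ⟨s, hs, hs0, hst⟩ := (h₁.and h₂).exists
    have hcs : c * (s / c) = s := by field_simp
    refine ⟨s / c, by positivity, by rw [hcs]; exact_mod_cast hst, ?_⟩
    have hlt : g (s / c) < g (t / c) :=
      hasSum_pow_strictMono hw (by positivity) (div_lt_div_of_pos_right hst hc0)
        (hg _ (by positivity) (by exact_mod_cast (div_lt_self hs0 hc).trans hst))
        (hg _ (by positivity) (by exact_mod_cast htc))
    rw [hcs]
    exact (mul_lt_mul_of_pos_left hlt hr).trans hs

lemma exists_eq_mul_of_blowup (hw : ∀ n, 0 < w n) (hθp : 0 < θp)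
    (hg : ∀ θ : ℝ, 0 < θ → (θ : EReal) < θp → HasSum (fun n => w n * θ ^ n) (g θ))
    (hcont : ∀ θ : ℝ, 0 < θ → (θ : EReal) < θp → ContinuousAt g θ)
    (hzero : Tendsto g (nhdsWithin 0 (Ioi 0)) (nhds (w 0)))
    (hblow : ∀ t : ℝ, θp = (t : EReal) → Tendsto g (nhdsWithin t (Iio t)) atTop)
    {c r : ℝ} (hc : 1 < c) (hr : 1 < r) :
    ∃ θ, 0 < θ ∧ ((c * θ : ℝ) : EReal) < θp ∧ g (c * θ) = r * g θ := by
  have hc0 : 0 < c := one_pos.trans hc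
  obtain ⟨b, hb, hbp, hbr⟩ := exists_mul_lt_of_blowup hw hθp hg hblow hc (one_pos.trans hr)
  have hev := hzero.eventually (gt_mem_nhds (show w 0 < r * w 0 by nlinarith [hw 0]))
  obtain ⟨s, hs, hs0, hsb⟩ := (hev.and (Ioo_mem_nhdsGT (mul_pos hc0 hb))).exists
  have hcs : c * (s / c) = s := by field_simp
  have ha : 0 < s / c := by positivity
  have hab : s / c < b := by rwa [div_lt_iff₀' hc0]
  have hdom : ∀ x ∈ Icc (s / c) b, 0 < x ∧ ((c * x : ℝ) : EReal) < θp := fun x hx =>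
    ⟨ha.trans_le hx.1, lt_of_le_of_lt
      (EReal.coe_le_coe_iff.2 (mul_le_mul_of_nonneg_left hx.2 hc0.le)) hbp⟩
  have hga : w 0 ≤ g (s / c) := by
    have hd := hdom (s / c) (left_mem_Icc.2 hab.le)
    simpa using le_hasSum (hg _ hd.1 (coe_lt_of_coe_mul_lt hc hd.1 hd.2)) 0
      fun n _ => mul_nonneg (hw n).le (by positivity)
  have hF : ContinuousOn (fun x => g (c * x) - r * g x) (Icc (s / c) b) := by
    intro x hx
    obtain ⟨hx0, hxp⟩ := hdom x hx
    refine ContinuousAt.continuousWithinAt (ContinuousAt.sub ?_ ?_)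
    · exact ContinuousAt.comp (g := g) (hcont _ (by positivity) hxp) (by fun_prop)
    · exact continuousAt_const.mul (hcont x hx0 (coe_lt_of_coe_mul_lt hc hx0 hxp))
  have hmem : (0 : ℝ) ∈ Icc (g (c * (s / c)) - r * g (s / c)) (g (c * b) - r * g b) := by
    rw [hcs]
    constructor
    · nlinarith
    · linarith
  obtain ⟨x, hx, hx0⟩ := intermediate_value_Icc hab.le hF hmem
  exact ⟨x, (hdom x hx).1, (hdom x hx).2, sub_eq_zero.1 hx0⟩

/-- If `g` is a positive power series on `(0, θp)` and `x`, `y` solve `lam * g x = 1` and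
`lam * g y = r`, then `y` and `c * x` are ordered according to a threshold in `lam`. -/
lemma exists_threshold (hw : ∀ n, 0 < w n) (hθp : 0 < θp)
    (hg : ∀ θ : ℝ, 0 < θ → (θ : EReal) < θp → HasSum (fun n => w n * θ ^ n) (g θ))
    (hcont : ∀ θ : ℝ, 0 < θ → (θ : EReal) < θp → ContinuousAt g θ)
    (hzero : Tendsto g (nhdsWithin 0 (Ioi 0)) (nhds (w 0)))
    (hblow : ∀ t : ℝ, θp = (t : EReal) → Tendsto g (nhdsWithin t (Iio t)) atTop)
    {c r : ℝ} (hc : 1 < c) (hr : 1 < r) :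
    ∃ lamstar : ℝ, 0 < lamstar ∧ lamstar < 1 / w 0 ∧
      ∀ lam x y : ℝ, 0 < lam → 0 < x → (x : EReal) < θp → 0 < y → (y : EReal) < θp →
        lam * g x = 1 → lam * g y = r →
        (lam < lamstar → y < c * x) ∧ (lamstar < lam → c * x < y) := by
  have hc0 : 0 < c := one_pos.trans hc
  have mono : ∀ x y : ℝ, 0 < x → x < y → (y : EReal) < θp → g x < g y :=
    fun x y hx hxy hy => hasSum_pow_strictMono hw hx hxy
      (hg x hx ((EReal.coe_lt_coe_iff.2 hxy).trans hy)) (hg y (hx.trans hxy) hy)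
  have lower : ∀ x : ℝ, 0 < x → (x : EReal) < θp → w 0 < g x := fun x hx hxp =>
    hasSum_lt (i := 1) (f := fun n => if n = 0 then w 0 else 0)
      (fun n => by
        dsimp only
        split_ifs with h
        · simp [h]
        · exact mul_nonneg (hw n).le (by positivity))
      (by simpa using mul_pos (hw 1) hx) (hasSum_ite_eq 0 (w 0)) (hg x hx hxp)
  have reflect : ∀ x y : ℝ, 0 < x → (x : EReal) < θp → 0 < y → (y : EReal) < θp →
      g x < g y → x < y := by
    intro x y hx hxp hy hyp h
    by_contra! hle
    rcases hle.eq_or_lt with rfl | hlt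
    · exact lt_irrefl _ h
    · exact lt_asymm h (mono y x hy hlt hxp)
  obtain ⟨z, hz, hcz, hgz⟩ := exists_eq_mul_of_blowup hw hθp hg hcont hzero hblow hc hr
  have hzp := coe_lt_of_coe_mul_lt hc hz hcz
  have hgz0 : 0 < g z := (hw 0).trans (lower z hz hzp)
  have ratio : ∀ x y : ℝ, 0 < x → x < y → ((c * y : ℝ) : EReal) < θp →
      g (c * x) * g y < g (c * y) * g x := by
    intro x y hx hxy hy
    have hy0 := hx.trans hxy
    have hcx : ((c * x : ℝ) : EReal) < θp :=
      (EReal.coe_lt_coe_iff.2 (mul_lt_mul_of_pos_left hxy hc0)).trans hy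
    exact hasSum_pow_ratio_strictMono hw hx hxy hc (hg x hx (coe_lt_of_coe_mul_lt hc hx hcx))
      (hg y hy0 (coe_lt_of_coe_mul_lt hc hy0 hy)) (hg _ (by positivity) hcx)
      (hg _ (by positivity) hy)
  refine ⟨1 / g z, by positivity, one_div_lt_one_div_of_lt (hw 0) (lower z hz hzp), ?_⟩
  intro lam x y hlam hx hxp hy hyp hgx hgy
  have hgx0 : 0 < g x := (hw 0).trans (lower x hx hxp)
  have hyx : g y = r * g x := by
    apply mul_left_cancel₀ hlam.ne'
    linear_combination hgy - r * hgx
  constructor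
  · intro h
    rw [lt_div_iff₀ hgz0, ← hgx] at h
    have hzx : z < x := reflect z x hz hzp hx hxp (lt_of_mul_lt_mul_left h hlam.le)
    rcases lt_or_ge ((c * x : ℝ) : EReal) θp with hcx | hcx
    · refine reflect _ _ hy hyp (by positivity) hcx ?_
      have := ratio z x hz hzx hcx
      rw [hgz] at this
      rw [hyx]
      nlinarith
    · exact EReal.coe_lt_coe_iff.1 (hyp.trans_le hcx)
  · intro h
    rw [div_lt_iff₀ hgz0, ← hgx] at h
    have hxz : x < z := reflect x z hx hxp hz hzp (lt_of_mul_lt_mul_left h hlam.le)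
    have hcx : ((c * x : ℝ) : EReal) < θp :=
      (EReal.coe_lt_coe_iff.2 (mul_lt_mul_of_pos_left hxz hc0)).trans hcz
    refine reflect _ _ (by positivity) hcx hy hyp ?_
    have := ratio x z hx hxz hcz
    rw [hgz] at this
    rw [hyx]
    nlinarith

end Crossing

section MomentSeries

variable {Ω : Type*} [MeasurableSpace Ω] {μ : Measure Ω} {ξ : Ω → ℝ}

lemma integral_pow_pos (hnn : ∀ᵐ ω ∂μ, 0 ≤ ξ ω) (hpp : 0 < μ {ω | 0 < ξ ω}) {n : ℕ}
    (hn : Integrable (fun ω => ξ ω ^ n) μ) : 0 < ∫ ω, ξ ω ^ n ∂μ := by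
  rw [integral_pos_iff_support_of_nonneg_ae (hnn.mono fun ω h => pow_nonneg h n) hn]
  exact hpp.trans_le (measure_mono fun ω hω => (pow_pos hω n).ne')

lemma hasSum_integral_pow_div_factorial [IsProbabilityMeasure μ] (hmeas : Measurable ξ)
    (hnn : ∀ᵐ ω ∂μ, 0 ≤ ξ ω) {θ : ℝ} (hθ : 0 < θ)
    (hfin : Integrable (fun ω => Real.exp (θ * ξ ω)) μ) :
    HasSum (fun n : ℕ => (∫ ω, ξ ω ^ (n + 1) ∂μ) / (n + 1).factorial * θ ^ n)
      (((∫ ω, Real.exp (θ * ξ ω) ∂μ) - 1) / θ) := by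
  have hexp : ∀ x : ℝ, HasSum (fun n : ℕ => x ^ (n + 1) / (n + 1).factorial)
      (Real.exp x - 1) := by
    intro x
    have h := NormedSpace.expSeries_div_hasSum_exp x
    rw [← Real.exp_eq_exp_ℝ, ← hasSum_nat_add_iff' 1] at h
    simpa using h
  have hsum : HasSum (fun n : ℕ => ∫ ω, (θ * ξ ω) ^ (n + 1) / (n + 1).factorial ∂μ)
      (∫ ω, (Real.exp (θ * ξ ω) - 1) ∂μ) := by
    refine hasSum_integral_of_dominated_convergence
      (fun n ω => (θ * ξ ω) ^ (n + 1) / (n + 1).factorial) (fun n => ?_) (fun n => ?_) ?_ ?_ ?_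
    · exact Measurable.aestronglyMeasurable (by fun_prop)
    · filter_upwards [hnn] with ω hω
      rw [Real.norm_of_nonneg (by positivity)]
    · exact ae_of_all _ fun ω => (hexp _).summable
    · simp_rw [(hexp _).tsum_eq]
      exact hfin.sub (integrable_const 1)
    · exact ae_of_all _ fun ω => hexp _
  rw [integral_sub hfin (integrable_const 1)] at hsum
  convert! hsum.div_const θ using 1
  · ext n
    simp_rw [mul_pow, mul_div_assoc, integral_const_mul, integral_div]
    field_simp
    ring
  · simp

end MomentSeries

/-- Lemma 2, part 1: for k ≥ 3 and 1 ≤ l ≤ k−2 there is a threshold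
λ*_{k,l} ∈ (0, λ̂) separating (l+1)·θ(λ,l) < k·θ*(λ) from the opposite inequality. -/
theorem stmt_9
    {Ω : Type*} [MeasurableSpace Ω] (μ : Measure Ω) [IsProbabilityMeasure μ]
    (ξ : Ω → ℝ) (hmeas : Measurable ξ)
    (hnn : ∀ᵐ ω ∂μ, 0 ≤ ξ ω)
    (hint : Integrable ξ μ)
    (hmean : 0 < ∫ ω, ξ ω ∂μ)
    (hpp : 0 < μ {ω | 0 < ξ ω})
    (θp : EReal) (hθp : 0 < θp)
    (φ : ℝ → ℝ) (hφ : ∀ θ : ℝ, φ θ = ∫ ω, Real.exp (θ * ξ ω) ∂μ)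
    (hfin : ∀ θ : ℝ, (θ : EReal) < θp →
      Integrable (fun ω => Real.exp (θ * ξ ω)) μ)
    (hblow : ∀ t : ℝ, θp = (t : EReal) →
      Filter.Tendsto φ (nhdsWithin t (Set.Iio t)) Filter.atTop)
    (lamhat : ℝ) (hlamhat : lamhat = 1 / deriv φ 0)
    (k l : ℕ) (hk : 3 ≤ k) (hl : 1 ≤ l) (hlk : l + 2 ≤ k)
    (θL : ℝ → ℝ)
    (hθL : ∀ lam : ℝ, 0 < lam → lam < ((l : ℝ) + 1) / (l : ℝ) * lamhat →
      (0 < θL lam ∧ (θL lam : EReal) < θp) ∧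
        ((l : ℝ) + 1) * θL lam = (l : ℝ) * lam * (φ (θL lam) - 1))
    (θS : ℝ → ℝ)
    (hθS : ∀ lam : ℝ, 0 < lam → lam < lamhat →
      (0 < θS lam ∧ (θS lam : EReal) < θp) ∧
        θS lam = lam * (φ (θS lam) - 1)) :
    ∃ lamstar : ℝ, 0 < lamstar ∧ lamstar < lamhat ∧
      (∀ lam : ℝ, 0 < lam → lam < lamstar →
        ((l : ℝ) + 1) * θL lam < (k : ℝ) * θS lam) ∧
      (∀ lam : ℝ, lamstar < lam → lam < lamhat →
        (k : ℝ) * θS lam < ((l : ℝ) + 1) * θL lam) := by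
  have hφ' : φ = ProbabilityTheory.mgf ξ μ := funext hφ
  have hset : {θ : ℝ | (θ : EReal) < θp} ⊆
      interior (ProbabilityTheory.integrableExpSet ξ μ) :=
    interior_maximal (fun θ hθ => hfin θ hθ)
      (isOpen_Iio.preimage continuous_coe_real_ereal)
  have hzero_mem : (0 : ℝ) ∈ interior (ProbabilityTheory.integrableExpSet ξ μ) :=
    hset (by simpa using hθp)
  have hφ0 : φ 0 = 1 := by simp [hφ]
  set w : ℕ → ℝ := fun n => (∫ ω, ξ ω ^ (n + 1) ∂μ) / (n + 1).factorial with hw_def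
  have hw : ∀ n, 0 < w n := fun n =>
    div_pos (integral_pow_pos hnn hpp
      (ProbabilityTheory.integrable_pow_of_mem_interior_integrableExpSet hzero_mem (n + 1)))
      (by positivity)
  have hw0 : w 0 = deriv φ 0 := by
    rw [hφ', ProbabilityTheory.deriv_mgf_zero hzero_mem]
    simp [hw_def]
  have hg : ∀ θ : ℝ, 0 < θ → (θ : EReal) < θp →
      HasSum (fun n => w n * θ ^ n) ((φ θ - 1) / θ) := fun θ hθ hθp' => by
    rw [hφ]
    exact hasSum_integral_pow_div_factorial hmeas hnn hθ (hfin θ hθp')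
  have hcont : ∀ θ : ℝ, 0 < θ → (θ : EReal) < θp →
      ContinuousAt (fun θ => (φ θ - 1) / θ) θ := fun θ hθ hθp' => by
    have : ContinuousAt φ θ := by
      rw [hφ']
      exact (ProbabilityTheory.differentiableAt_mgf (hset hθp')).continuousAt
    exact (this.sub continuousAt_const).div continuousAt_id hθ.ne'
  have hlim : Tendsto (fun θ => (φ θ - 1) / θ) (nhdsWithin 0 (Ioi 0)) (nhds (w 0)) := by
    have hd : HasDerivAt φ (w 0) 0 := by
      rw [hw0, hφ']
      exact (ProbabilityTheory.differentiableAt_mgf hzero_mem).hasDerivAt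
    have := hd.tendsto_slope_zero_right
    simpa [hφ0, div_eq_inv_mul] using this
  have hblow' : ∀ t : ℝ, θp = (t : EReal) →
      Tendsto (fun θ => (φ θ - 1) / θ) (nhdsWithin t (Iio t)) atTop := fun t ht => by
    have ht0 : 0 < t := by
      rw [ht] at hθp
      exact_mod_cast hθp
    simp_rw [div_eq_mul_inv]
    refine Tendsto.atTop_mul_pos (inv_pos.2 ht0)
      (tendsto_atTop_add_const_right _ (-1) (hblow t ht)) ?_
    exact (tendsto_inv₀ ht0.ne').mono_left nhdsWithin_le_nhds
  have hl0 : (0 : ℝ) < l := by exact_mod_cast hl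
  have hc : 1 < (k : ℝ) / (l + 1) := by
    rw [one_lt_div (by positivity)]
    exact_mod_cast hlk
  have hr : 1 < ((l : ℝ) + 1) / l := by
    rw [one_lt_div hl0]
    linarith
  rw [← hw0] at hlamhat
  have hlamhat0 : 0 < lamhat := hlamhat ▸ one_div_pos.2 (hw 0)
  obtain ⟨lamstar, hpos, hlt, H⟩ := exists_threshold hw hθp hg hcont hlim hblow' hc hr
  have compare : ∀ lam : ℝ, 0 < lam → lam < lamhat →
      (lam < lamstar → θL lam < (k : ℝ) / (l + 1) * θS lam) ∧
      (lamstar < lam → (k : ℝ) / (l + 1) * θS lam < θL lam) := by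
    intro lam h0 h1
    obtain ⟨⟨hS0, hSp⟩, hS⟩ := hθS lam h0 h1
    obtain ⟨⟨hL0, hLp⟩, hL⟩ := hθL lam h0 (by nlinarith)
    refine H lam _ _ h0 hS0 hSp hL0 hLp ?_ ?_
    · rw [← mul_div_assoc, ← hS, div_self hS0.ne']
    · rw [← mul_div_assoc, div_eq_div_iff hL0.ne' hl0.ne', hL]
      ring
  have hl1 : (0 : ℝ) < l + 1 := by positivity
  refine ⟨lamstar, hpos, hlamhat ▸ hlt, fun lam h0 h => ?_, fun lam h h1 => ?_⟩
  · have := (compare lam h0 (h.trans (hlamhat ▸ hlt))).1 h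
    rwa [div_mul_eq_mul_div, lt_div_iff₀' hl1] at this
  · have := (compare lam (hpos.trans h) h1).2 h
    rwa [div_mul_eq_mul_div, div_lt_iff₀' hl1] at this
end

section
/- (Lemma 2, part 2.) For all integers l₁, l₂ with 1 ≤ l₁ < l₂ there exists λ_{l₂,l₁} with 0 < λ_{l₂,l₁} < ((l₂+1)/l₂)·λ̂ such that: for every λ with 0 < λ < λ_{l₂,l₁} one has (l₁+1)·θ(λ,l₁) < (l₂+1)·θ(λ,l₂) (i.e. J(λ,l₁) < J(λ,l₂)), and for every λ with λ_{l₂,l₁} < λ < ((l₂+1)/l₂)·λ̂ one has (l₁+1)·θ(λ,l₁) > (l₂+1)·θ(λ,l₂) (i.e. J(λ,l₁) > J(λ,l₂)). -/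
open MeasureTheory Filter Set

/-- Two strictly star-shaped functions `G₁`, `G₂` whose difference is also strictly star-shaped:
the roots of `s = lam * Gᵢ s` are ordered according to the position of `lam` relative to the
value `c` at which both equations share a root. -/
theorem roots_compare {P₁ P₂ : ℝ → Prop} (hP : ∀ s, 0 < s → P₁ s → P₂ s) {G₁ G₂ : ℝ → ℝ}
    (hG₁ : ∀ s t, 0 < s → s < t → P₁ t → t * G₁ s < s * G₁ t)
    (hG₂ : ∀ s t, 0 < s → s < t → P₂ t → t * G₂ s < s * G₂ t)
    (hF : ∀ s t, 0 < s → s < t → P₁ t → t * (G₁ s - G₂ s) < s * (G₁ t - G₂ t))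
    {r c lam s₁ s₂ : ℝ} (hr : 0 < r) (hPr : P₁ r) (hGr : G₁ r = G₂ r) (hc : 0 < c)
    (hcr : r = c * G₁ r) (hlam : 0 < lam)
    (hs₁ : 0 < s₁) (hP₁ : P₁ s₁) (h₁ : s₁ = lam * G₁ s₁)
    (hs₂ : 0 < s₂) (hP₂ : P₂ s₂) (h₂ : s₂ = lam * G₂ s₂) :
    (lam < c → s₁ < s₂) ∧ (c < lam → s₂ < s₁) := by
  have e₁ : G₁ s₁ = s₁ / lam := by rw [eq_div_iff hlam.ne']; linarith
  have e₂ : G₂ s₂ = s₂ / lam := by rw [eq_div_iff hlam.ne']; linarith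
  have er : G₁ r = r / c := by rw [eq_div_iff hc.ne']; linarith
  have er' : G₂ r = r / c := by rw [← hGr, er]
  constructor
  · intro h
    have hrs : r < s₁ := by
      by_contra! hle
      rcases hle.eq_or_lt with rfl | hlt
      · rw [er, div_eq_div_iff hc.ne' hlam.ne'] at e₁
        have := mul_left_cancel₀ hr.ne' e₁
        linarith
      · have := hG₁ _ _ hs₁ hlt hPr
        rw [e₁, er, ← mul_div_assoc, ← mul_div_assoc, div_lt_div_iff₀ hlam hc] at this
        nlinarith [mul_pos hr hs₁]
    have hpos := hF _ _ hr hrs hP₁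
    rw [hGr, sub_self, mul_zero] at hpos
    have hpos := pos_of_mul_pos_right hpos hr.le
    by_contra! hle
    rcases hle.eq_or_lt with rfl | hlt
    · linarith
    · have := hG₂ _ _ hs₂ hlt (hP _ hs₁ hP₁)
      rw [e₂, show s₁ * (s₂ / lam) = s₂ * (s₁ / lam) by ring, ← e₁] at this
      have := lt_of_mul_lt_mul_left this hs₂.le
      linarith
  · intro h
    have hrs : s₁ < r := by
      by_contra! hle
      rcases hle.eq_or_lt with rfl | hlt
      · rw [er, div_eq_div_iff hc.ne' hlam.ne'] at e₁
        have := mul_left_cancel₀ hr.ne' e₁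
        linarith
      · have := hG₁ _ _ hr hlt hP₁
        rw [e₁, er, ← mul_div_assoc, ← mul_div_assoc, div_lt_div_iff₀ hc hlam] at this
        nlinarith [mul_pos hr hs₁]
    have hneg := hF _ _ hs₁ hrs hPr
    rw [hGr, sub_self, mul_zero] at hneg
    have hneg := neg_of_mul_neg_right hneg hr.le
    by_contra! hle
    rcases hle.eq_or_lt with rfl | hlt
    · linarith
    · have := hG₂ _ _ hs₁ hlt hP₂
      rw [e₂, show s₁ * (s₂ / lam) = s₂ * (s₁ / lam) by ring, ← e₁] at this
      have := lt_of_mul_lt_mul_left this hs₂.le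
      linarith

/-- Strict star-shapedness of a strictly convex function vanishing at the origin. -/
theorem StrictConvexOn.mul_lt_mul_of_zero {p : ℝ → ℝ} (hp : StrictConvexOn ℝ (Ici 0) p)
    (h0 : p 0 = 0) {v w : ℝ} (hv : 0 < v) (hvw : v < w) : w * p v < v * p w := by
  have hw := hv.trans hvw
  have := hp.secant_strict_mono (a := 0) (x := v) (y := w) self_mem_Ici (mem_Ici.2 hv.le)
    (mem_Ici.2 hw.le) hv.ne' hw.ne' hvw
  simp only [h0, sub_zero] at this
  rw [div_lt_div_iff₀ hv hw] at this
  linarith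

theorem integral_lt_integral_of_lt_of_pos {Ω : Type*} [MeasurableSpace Ω] {μ : Measure Ω}
    {ξ : Ω → ℝ} (hnn : ∀ᵐ ω ∂μ, 0 ≤ ξ ω) (hpp : 0 < μ {ω | 0 < ξ ω}) {f g : ℝ → ℝ}
    (hfg0 : f 0 = g 0) (hfg : ∀ x, 0 < x → f x < g x)
    (hf : Integrable (fun ω => f (ξ ω)) μ) (hg : Integrable (fun ω => g (ξ ω)) μ) :
    ∫ ω, f (ξ ω) ∂μ < ∫ ω, g (ξ ω) ∂μ := by
  have hle : ∀ᵐ ω ∂μ, 0 ≤ g (ξ ω) - f (ξ ω) := by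
    filter_upwards [hnn] with ω hω
    rcases hω.eq_or_lt with h | h
    · rw [← h, hfg0, sub_self]
    · exact (sub_pos.2 (hfg _ h)).le
  rw [← sub_pos, ← integral_sub hg hf, integral_pos_iff_support_of_nonneg_ae hle (hg.sub hf)]
  exact hpp.trans_le (measure_mono fun ω hω => (sub_pos.2 (hfg _ hω)).ne')

theorem StrictConvexOn.mul_integral_lt {Ω : Type*} [MeasurableSpace Ω] {μ : Measure Ω}
    {ξ : Ω → ℝ} (hnn : ∀ᵐ ω ∂μ, 0 ≤ ξ ω) (hpp : 0 < μ {ω | 0 < ξ ω}) {p : ℝ → ℝ}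
    (hp : StrictConvexOn ℝ (Ici 0) p) (h0 : p 0 = 0) {s t : ℝ} (hs : 0 < s) (hst : s < t)
    (his : Integrable (fun ω => p (s * ξ ω)) μ) (hit : Integrable (fun ω => p (t * ξ ω)) μ) :
    t * ∫ ω, p (s * ξ ω) ∂μ < s * ∫ ω, p (t * ξ ω) ∂μ := by
  rw [← integral_const_mul, ← integral_const_mul]
  refine integral_lt_integral_of_lt_of_pos (f := fun x => t * p (s * x))
    (g := fun x => s * p (t * x)) hnn hpp (by simp [h0]) (fun x hx => ?_)
    (his.const_mul t) (hit.const_mul s)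
  have := hp.mul_lt_mul_of_zero h0 (mul_pos hs hx) (mul_lt_mul_of_pos_right hst hx)
  rw [show t * x * p (s * x) = x * (t * p (s * x)) by ring,
    show s * x * p (t * x) = x * (s * p (t * x)) by ring] at this
  exact lt_of_mul_lt_mul_left this hx.le

theorem strictConvexOn_exp_div_sub {k l : ℝ} (hk : 1 ≤ k) (hkl : k < l) :
    StrictConvexOn ℝ (Ici 0) fun u : ℝ =>
      k * (Real.exp (u / (k + 1)) - 1) - l * (Real.exp (u / (l + 1)) - 1) := by
  have d : ∀ c e u : ℝ, HasDerivAt (fun u : ℝ => e * Real.exp (u / c))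
      (e / c * Real.exp (u / c)) u := fun c e u => by
    exact (((hasDerivAt_id' u).div_const c).exp.const_mul e).congr_deriv (by ring)
  have d1 : deriv (fun u : ℝ =>
      k * (Real.exp (u / (k + 1)) - 1) - l * (Real.exp (u / (l + 1)) - 1)) = fun u =>
      k / (k + 1) * Real.exp (u / (k + 1)) - l / (l + 1) * Real.exp (u / (l + 1)) := by
    funext u
    have := (((d (k + 1) k u).sub_const k).sub ((d (l + 1) l u).sub_const l)).deriv
    rw [← this]
    congr 1
    funext u
    simp only [Pi.sub_apply]; ring
  refine strictConvexOn_of_deriv2_pos (convex_Ici 0) (by fun_prop) fun u hu => ?_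
  rw [interior_Ici, mem_Ioi] at hu
  simp only [Function.iterate_succ, Function.iterate_zero, Function.comp, id]
  have d2 := ((d (k + 1) (k / (k + 1)) u).sub (d (l + 1) (l / (l + 1)) u)).deriv
  rw [d1]
  refine lt_of_lt_of_eq ?_ d2.symm
  have hl : 0 < l := by linarith
  have hcoef : l / (l + 1) / (l + 1) < k / (k + 1) / (k + 1) := by
    rw [div_div, div_div, div_lt_div_iff₀ (by positivity) (by positivity)]
    nlinarith [mul_pos (sub_pos.2 hkl) (show 0 < k * l - 1 by nlinarith)]
  have hexp : Real.exp (u / (l + 1)) ≤ Real.exp (u / (k + 1)) := by gcongr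
  have : 0 ≤ l / (l + 1) / (l + 1) := by positivity
  have := Real.exp_pos (u / (k + 1))
  nlinarith

/-- `exp (u / b)` is negligible compared to `exp (u / a)` for `a < b`, up to a constant. -/
theorem exists_mul_exp_div_le {a b K : ℝ} (ha : 0 < a) (hab : a < b) (hK : 0 < K) :
    ∃ C, ∀ u : ℝ, 0 ≤ u → K * Real.exp (u / b) ≤ Real.exp (u / a) + C := by
  have hb := ha.trans hab
  have hd : 0 < 1 / a - 1 / b := sub_pos.2 (one_div_lt_one_div_of_lt ha hab)
  refine ⟨K * Real.exp (Real.log K / (1 / a - 1 / b) / b), fun u _ => ?_⟩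
  by_cases h : u ≤ Real.log K / (1 / a - 1 / b)
  · have : K * Real.exp (u / b) ≤ K * Real.exp (Real.log K / (1 / a - 1 / b) / b) := by gcongr
    linarith [Real.exp_pos (u / a)]
  · push Not at h
    rw [div_lt_iff₀ hd] at h
    have : K * Real.exp (u / b) ≤ Real.exp (u / a) := by
      conv_lhs => rw [← Real.exp_log hK, ← Real.exp_add]
      apply Real.exp_le_exp.2
      have : u * (1 / a - 1 / b) = u / a - u / b := by ring
      linarith
    have : 0 ≤ K * Real.exp (Real.log K / (1 / a - 1 / b) / b) := by positivity
    linarith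

section Mgf

variable {Ω : Type*} [MeasurableSpace Ω] {μ : Measure Ω} [IsProbabilityMeasure μ] {ξ : Ω → ℝ}

theorem ProbabilityTheory.mul_mgf_sub_one_lt (hnn : ∀ᵐ ω ∂μ, 0 ≤ ξ ω) (hpp : 0 < μ {ω | 0 < ξ ω})
    {s t : ℝ} (hs : 0 < s) (hst : s < t) (his : Integrable (fun ω => Real.exp (s * ξ ω)) μ)
    (hit : Integrable (fun ω => Real.exp (t * ξ ω)) μ) :
    t * (mgf ξ μ s - 1) < s * (mgf ξ μ t - 1) := by
  have e : ∀ r, Integrable (fun ω => Real.exp (r * ξ ω)) μ →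
      mgf ξ μ r - 1 = ∫ ω, (Real.exp (r * ξ ω) - 1) ∂μ := fun r hr => by
    rw [integral_sub hr (integrable_const 1)]; simp [mgf]
  have hc : StrictConvexOn ℝ (Ici 0) fun x : ℝ => Real.exp x - 1 :=
    (strictConvexOn_exp.subset (subset_univ _) (convex_Ici 0)).sub_concaveOn
      (concaveOn_const 1 (convex_Ici 0))
  rw [e s his, e t hit]
  exact hc.mul_integral_lt hnn hpp (by simp) hs hst (his.sub (integrable_const 1))
    (hit.sub (integrable_const 1))

theorem ProbabilityTheory.one_add_mul_lt_mgf (hnn : ∀ᵐ ω ∂μ, 0 ≤ ξ ω)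
    (hpp : 0 < μ {ω | 0 < ξ ω}) (hint : Integrable ξ μ) {t : ℝ} (ht : 0 < t)
    (hit : Integrable (fun ω => Real.exp (t * ξ ω)) μ) :
    1 + t * ∫ ω, ξ ω ∂μ < mgf ξ μ t := by
  have e : 1 + t * ∫ ω, ξ ω ∂μ = ∫ ω, (1 + t * ξ ω) ∂μ := by
    rw [integral_add (integrable_const 1) (hint.const_mul t), integral_const_mul]; simp
  rw [e]
  refine integral_lt_integral_of_lt_of_pos (f := fun x => 1 + t * x)
    (g := fun x => Real.exp (t * x)) hnn hpp (by simp) (fun x hx => ?_)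
    ((integrable_const 1).add (hint.const_mul t)) hit
  have := Real.add_one_lt_exp (mul_pos ht hx).ne'
  linarith

/-- The difference `k * (φ (s / (k + 1)) - 1) - l * (φ (s / (l + 1)) - 1)` is strictly
star-shaped in `s`. -/
theorem ProbabilityTheory.mul_mgf_div_sub_lt (hnn : ∀ᵐ ω ∂μ, 0 ≤ ξ ω)
    (hpp : 0 < μ {ω | 0 < ξ ω}) {k l : ℝ} (hk : 1 ≤ k) (hkl : k < l) {s t : ℝ} (hs : 0 < s)
    (hst : s < t) (hi : ∀ r ≤ t / (k + 1), Integrable (fun ω => Real.exp (r * ξ ω)) μ) :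
    t * (k * (mgf ξ μ (s / (k + 1)) - 1) - l * (mgf ξ μ (s / (l + 1)) - 1)) <
      s * (k * (mgf ξ μ (t / (k + 1)) - 1) - l * (mgf ξ μ (t / (l + 1)) - 1)) := by
  set p : ℝ → ℝ := fun u : ℝ =>
    k * (Real.exp (u / (k + 1)) - 1) - l * (Real.exp (u / (l + 1)) - 1) with hp
  have hpr : ∀ r ω, p (r * ξ ω) = k * (Real.exp (r / (k + 1) * ξ ω) - 1) -
      l * (Real.exp (r / (l + 1) * ξ ω) - 1) := fun r ω => by
    simp only [hp]
    rw [show r * ξ ω / (k + 1) = r / (k + 1) * ξ ω by ring,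
      show r * ξ ω / (l + 1) = r / (l + 1) * ξ ω by ring]
  have hir : ∀ c r, Integrable (fun ω => Real.exp (r * ξ ω)) μ →
      Integrable (fun ω => c * (Real.exp (r * ξ ω) - 1)) μ :=
    fun c r h => (h.sub (integrable_const 1)).const_mul c
  have key : ∀ r, 0 < r → r ≤ t → Integrable (fun ω => p (r * ξ ω)) μ ∧
      ∫ ω, p (r * ξ ω) ∂μ =
        k * (mgf ξ μ (r / (k + 1)) - 1) - l * (mgf ξ μ (r / (l + 1)) - 1) := fun r hr hrt => by
    have hrk : r / (k + 1) ≤ t / (k + 1) := by gcongr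
    have i1 := hi _ hrk
    have i2 := hi (r / (l + 1)) (le_trans (by gcongr) hrk)
    simp only [hpr]
    refine ⟨(hir k _ i1).sub (hir l _ i2), ?_⟩
    rw [integral_sub (hir k _ i1) (hir l _ i2), integral_const_mul, integral_const_mul,
      integral_sub i1 (integrable_const 1), integral_sub i2 (integrable_const 1)]
    simp [mgf]
  obtain ⟨is, es⟩ := key s hs hst.le
  obtain ⟨it, et⟩ := key t (hs.trans hst) le_rfl
  rw [← es, ← et]
  exact (strictConvexOn_exp_div_sub hk hkl).mul_integral_lt hnn hpp (by simp) hs hst is it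

theorem ProbabilityTheory.exists_mul_mgf_div_le (hnn : ∀ᵐ ω ∂μ, 0 ≤ ξ ω) {a b K : ℝ}
    (ha : 0 < a) (hab : a < b) (hK : 0 < K) :
    ∃ C, ∀ s, 0 ≤ s → (∀ r ≤ s / a, Integrable (fun ω => Real.exp (r * ξ ω)) μ) →
      K * mgf ξ μ (s / b) ≤ mgf ξ μ (s / a) + C := by
  obtain ⟨C, hC⟩ := exists_mul_exp_div_le ha hab hK
  refine ⟨C, fun s hs hi => ?_⟩
  have i1 := hi _ le_rfl
  have i2 := hi (s / b) (by gcongr)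
  have e : mgf ξ μ (s / a) + C = ∫ ω, (Real.exp (s / a * ξ ω) + C) ∂μ := by
    rw [integral_add i1 (integrable_const C)]; simp [mgf]
  rw [e, mgf, ← integral_const_mul]
  refine integral_mono_ae (i2.const_mul K) (i1.add (integrable_const C)) ?_
  filter_upwards [hnn] with ω hω
  have := hC (s * ξ ω) (by positivity)
  rwa [show s * ξ ω / a = s / a * ξ ω by ring, show s * ξ ω / b = s / b * ξ ω by ring] at this

end Mgf



/-- Lemma 2, part 2: for 1 ≤ l₁ < l₂ there is a threshold
λ_{l₂,l₁} ∈ (0, ((l₂+1)/l₂)·λ̂) separating (l₁+1)·θ(λ,l₁) < (l₂+1)·θ(λ,l₂)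
from the opposite inequality. -/
theorem stmt_10
    {Ω : Type*} [MeasurableSpace Ω] (μ : Measure Ω) [IsProbabilityMeasure μ]
    (ξ : Ω → ℝ) (hmeas : Measurable ξ)
    (hnn : ∀ᵐ ω ∂μ, 0 ≤ ξ ω)
    (hint : Integrable ξ μ)
    (hmean : 0 < ∫ ω, ξ ω ∂μ)
    (hpp : 0 < μ {ω | 0 < ξ ω})
    (θp : EReal) (hθp : 0 < θp)
    (φ : ℝ → ℝ) (hφ : ∀ θ : ℝ, φ θ = ∫ ω, Real.exp (θ * ξ ω) ∂μ)
    (hfin : ∀ θ : ℝ, (θ : EReal) < θp →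
      Integrable (fun ω => Real.exp (θ * ξ ω)) μ)
    (hblow : ∀ t : ℝ, θp = (t : EReal) →
      Filter.Tendsto φ (nhdsWithin t (Set.Iio t)) Filter.atTop)
    (lamhat : ℝ) (hlamhat : lamhat = 1 / deriv φ 0)
    (l₁ l₂ : ℕ) (hl₁ : 1 ≤ l₁) (hl : l₁ < l₂)
    (θL₁ : ℝ → ℝ)
    (hθL₁ : ∀ lam : ℝ, 0 < lam → lam < ((l₁ : ℝ) + 1) / (l₁ : ℝ) * lamhat →
      (0 < θL₁ lam ∧ (θL₁ lam : EReal) < θp) ∧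
        ((l₁ : ℝ) + 1) * θL₁ lam = (l₁ : ℝ) * lam * (φ (θL₁ lam) - 1))
    (θL₂ : ℝ → ℝ)
    (hθL₂ : ∀ lam : ℝ, 0 < lam → lam < ((l₂ : ℝ) + 1) / (l₂ : ℝ) * lamhat →
      (0 < θL₂ lam ∧ (θL₂ lam : EReal) < θp) ∧
        ((l₂ : ℝ) + 1) * θL₂ lam = (l₂ : ℝ) * lam * (φ (θL₂ lam) - 1)) :
    ∃ lamc : ℝ, 0 < lamc ∧ lamc < ((l₂ : ℝ) + 1) / (l₂ : ℝ) * lamhat ∧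
      (∀ lam : ℝ, 0 < lam → lam < lamc →
        ((l₁ : ℝ) + 1) * θL₁ lam < ((l₂ : ℝ) + 1) * θL₂ lam) ∧
      (∀ lam : ℝ, lamc < lam → lam < ((l₂ : ℝ) + 1) / (l₂ : ℝ) * lamhat →
        ((l₂ : ℝ) + 1) * θL₂ lam < ((l₁ : ℝ) + 1) * θL₁ lam) := by
  obtain rfl : φ = ProbabilityTheory.mgf ξ μ := funext hφ
  set φ := ProbabilityTheory.mgf ξ μ
  set m := ∫ ω, ξ ω ∂μ
  have hU : IsOpen {θ : ℝ | (θ : EReal) < θp} :=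
    isOpen_Iio.preimage continuous_coe_real_ereal
  have hUint : ∀ θ : ℝ, (θ : EReal) < θp →
      θ ∈ interior (ProbabilityTheory.integrableExpSet ξ μ) :=
    fun θ hθ => interior_maximal (fun r hr => hfin r hr) hU hθ
  have hdown : ∀ {r t : ℝ}, r ≤ t → (t : EReal) < θp → (r : EReal) < θp :=
    fun h ht => (EReal.coe_le_coe_iff.2 h).trans_lt ht
  have hm : HasDerivAt φ m 0 := by
    have h0 := hUint 0 (by simpa using hθp)
    have := (ProbabilityTheory.differentiableAt_mgf h0).hasDerivAt
    rwa [ProbabilityTheory.deriv_mgf_zero h0] at this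
  rw [hm.deriv] at hlamhat
  subst hlamhat
  have hlow : ∀ t : ℝ, 0 < t → (t : EReal) < θp → 1 + t * m < φ t := fun t ht htp =>
    ProbabilityTheory.one_add_mul_lt_mgf hnn hpp hint ht (hfin t htp)
  have hunb : ∀ M : ℝ, ∃ t : ℝ, 0 < t ∧ (t : EReal) < θp ∧ M < φ t := fun M => by
    induction θp with
    | bot => simp at hθp
    | top =>
      have ht : 0 < (|M| + 1) / m := by positivity
      refine ⟨_, ht, EReal.coe_lt_top _, lt_trans ?_ (hlow _ ht (EReal.coe_lt_top _))⟩
      rw [div_mul_cancel₀ _ hmean.ne']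
      linarith [le_abs_self M]
    | coe T =>
      have hT : 0 < T := by exact_mod_cast hθp
      obtain ⟨t, ht, h0, hT⟩ := (((hblow T rfl).eventually_gt_atTop M).and
        (Ioo_mem_nhdsLT hT)).exists
      exact ⟨t, h0, by exact_mod_cast hT, ht⟩
  have hk : (1 : ℝ) ≤ l₁ := by exact_mod_cast hl₁
  have hkl : (l₁ : ℝ) < l₂ := by exact_mod_cast hl
  generalize (l₁ : ℝ) = k at *
  generalize (l₂ : ℝ) = l at *
  have hk0 : 0 < k := by linarith
  have hl0 : 0 < l := by linarith
  set G : ℝ → ℝ → ℝ := fun c s => c * (φ (s / (c + 1)) - 1) with hG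
  have hstar : ∀ c, 0 < c → ∀ s t, 0 < s → s < t → ((t / (c + 1) : ℝ) : EReal) < θp →
      t * G c s < s * G c t := fun c hc s t hs hst ht => by
    have hst' : s / (c + 1) < t / (c + 1) := by gcongr
    have := ProbabilityTheory.mul_mgf_sub_one_lt hnn hpp (by positivity) hst'
      (hfin _ (hdown hst'.le ht)) (hfin _ ht)
    have := mul_lt_mul_of_pos_left this (show 0 < c * (c + 1) by positivity)
    have e : ∀ x y : ℝ, c * (c + 1) * (x / (c + 1) * y) = x * (c * y) := fun x y => by
      field_simp
    rwa [e, e] at this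
  have hF : ∀ s t, 0 < s → s < t → ((t / (k + 1) : ℝ) : EReal) < θp →
      t * (G k s - G l s) < s * (G k t - G l t) := fun s t hs hst ht =>
    ProbabilityTheory.mul_mgf_div_sub_lt hnn hpp hk hkl hs hst
      fun r hr => hfin r (hdown hr ht)
  have hP : ∀ s : ℝ, 0 < s → ((s / (k + 1) : ℝ) : EReal) < θp →
      ((s / (l + 1) : ℝ) : EReal) < θp := fun s hs h => hdown (by gcongr) h
  have hneg : ∃ s, 0 < s ∧ ((s / (k + 1) : ℝ) : EReal) < θp ∧ G k s - G l s < 0 := by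
    have hd : ∀ c, 0 < c → HasDerivAt (G c) (c * (m / (c + 1))) 0 := fun c hc => by
      have h := HasDerivAt.comp (0 : ℝ) (h₂ := φ) (h := fun s => s / (c + 1)) (h₂' := m)
        (by simpa using hm) ((hasDerivAt_id (0 : ℝ)).div_const (c + 1))
      exact ((h.sub_const 1).const_mul c).congr_deriv (by ring)
    have hD := (hd k hk0).sub (hd l hl0)
    have hlt : k * (m / (k + 1)) - l * (m / (l + 1)) < 0 := by
      rw [sub_neg, ← mul_div_assoc, ← mul_div_assoc,
        div_lt_div_iff₀ (by positivity) (by positivity)]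
      nlinarith
    have h1 := ((hasDerivAt_iff_tendsto_slope.1 hD).eventually_lt_const hlt).filter_mono
      (nhdsWithin_mono 0 (fun x (hx : x ∈ Ioi (0 : ℝ)) => ne_of_gt hx))
    have h2 : ∀ᶠ s : ℝ in nhdsWithin 0 (Ioi 0), ((s / (k + 1) : ℝ) : EReal) < θp := by
      refine nhdsWithin_le_nhds ?_
      exact (hU.preimage (f := fun s : ℝ => s / (k + 1)) (by fun_prop)).mem_nhds
        (by simpa using hθp)
    obtain ⟨s, ⟨hs1, hs2⟩, hs0⟩ := ((h1.and h2).and self_mem_nhdsWithin).exists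
    refine ⟨s, hs0, hs2, ?_⟩
    have h00 : ∀ c, G c 0 = 0 := fun c => by simp [hG, φ]
    simp only [slope_def_field, Pi.sub_apply, h00, sub_zero] at hs1
    exact neg_of_div_neg_left hs1 (le_of_lt hs0)
  have hpos : ∃ t, 0 < t ∧ ((t / (k + 1) : ℝ) : EReal) < θp ∧ 0 < G k t - G l t := by
    obtain ⟨C, hC⟩ := ProbabilityTheory.exists_mul_mgf_div_le (μ := μ) hnn
      (show 0 < k + 1 by linarith) (show k + 1 < l + 1 by linarith)
      (show 0 < 2 * l / k by positivity)
    obtain ⟨t, ht, htp, hM⟩ := hunb (C + 2)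
    have htt : t * (k + 1) / (k + 1) = t := by field_simp
    have h := hC (t * (k + 1)) (by positivity) (fun r hr => hfin r (hdown (by linarith) htp))
    refine ⟨t * (k + 1), by positivity, by rwa [htt], ?_⟩
    simp only [hG, htt] at h ⊢
    change _ ≤ φ t + C at h
    change 2 * l / k * φ _ ≤ _ at h
    rw [div_mul_eq_mul_div, div_le_iff₀ hk0] at h
    nlinarith [mul_lt_mul_of_pos_left hM hk0]
  obtain ⟨s, hs, hsp, hsF⟩ := hneg
  obtain ⟨t, ht, htp, htF⟩ := hpos
  have hst : s < t := by
    by_contra! hle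
    rcases hle.eq_or_lt with rfl | hlt
    · linarith
    · have := hF t s ht hlt hsp
      nlinarith
  have hcont : ∀ c, k ≤ c → ContinuousOn (G c) (Icc s t) := fun c hc r hr => by
    have hr0 : 0 < r := hs.trans_le hr.1
    have hrp : ((r / (c + 1) : ℝ) : EReal) < θp := by
      refine hdown ?_ htp
      have := hr.2
      gcongr
    have hφc : ContinuousAt φ (r / (c + 1)) :=
      (ProbabilityTheory.differentiableAt_mgf (hUint _ hrp)).continuousAt
    have : ContinuousAt (fun s => φ (s / (c + 1))) r :=
      ContinuousAt.comp (f := fun s : ℝ => s / (c + 1)) hφc (by fun_prop)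
    exact ((this.sub continuousAt_const).const_mul c).continuousWithinAt
  obtain ⟨r, hr, hr0⟩ := intermediate_value_Icc hst.le ((hcont k le_rfl).sub (hcont l hkl.le))
    (show (0 : ℝ) ∈ Icc _ _ from ⟨hsF.le, htF.le⟩)
  have hGr : G k r = G l r := sub_eq_zero.1 hr0
  have hrpos : 0 < r := hs.trans_le hr.1
  have hrp : ((r / (k + 1) : ℝ) : EReal) < θp := by
    refine hdown ?_ htp
    have := hr.2
    gcongr
  have hlowr : r * m * l < (l + 1) * G l r := by
    have := hlow (r / (l + 1)) (by positivity) (hP r hrpos hrp)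
    have e : r / (l + 1) * m = r * m / (l + 1) := by ring
    rw [e, ← lt_sub_iff_add_lt', div_lt_iff₀ (by positivity)] at this
    simp only [hG]
    nlinarith
  have hGpos : 0 < G l r := by
    have : 0 < r * m * l := by positivity
    exact pos_of_mul_pos_right (this.trans hlowr) (by positivity)
  have hc : 0 < r / G k r := by rw [hGr]; positivity
  have hlamle : (l + 1) / l * (1 / m) ≤ (k + 1) / k * (1 / m) := by
    gcongr ?_ * _
    rw [div_le_div_iff₀ hl0 hk0]
    linarith
  have hlamc : r / G k r < (l + 1) / l * (1 / m) := by
    rw [hGr, div_mul_div_comm, mul_one, div_lt_div_iff₀ hGpos (by positivity)]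
    linarith
  have key : ∀ lam, 0 < lam → lam < (l + 1) / l * (1 / m) →
      (lam < r / G k r → (k + 1) * θL₁ lam < (l + 1) * θL₂ lam) ∧
      (r / G k r < lam → (l + 1) * θL₂ lam < (k + 1) * θL₁ lam) := fun lam h0 h1 => by
    obtain ⟨⟨a0, ap⟩, ae⟩ := hθL₁ lam h0 (h1.trans_le hlamle)
    obtain ⟨⟨b0, bp⟩, be⟩ := hθL₂ lam h0 h1
    have ea : (k + 1) * θL₁ lam / (k + 1) = θL₁ lam := by field_simp
    have eb : (l + 1) * θL₂ lam / (l + 1) = θL₂ lam := by field_simp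
    refine roots_compare hP (hstar k hk0) (hstar l hl0) hF hrpos hrp hGr hc
      (div_mul_cancel₀ r (hGr ▸ hGpos.ne')).symm h0 (by positivity) (by rwa [ea]) ?_
      (by positivity) (by rwa [eb]) ?_
    · simp only [hG, ea]; linarith
    · simp only [hG, eb]; linarith
  exact ⟨r / G k r, hc, hlamc, fun lam h0 h => (key lam h0 (h.trans hlamc)).1 h,
    fun lam h h1 => (key lam (hc.trans h) h1).2 h⟩
end

section
/- (Convergence of the critical rate.) For each integer k ≥ 3 let λ*_{k,1} ∈ (0, λ̂) be the unique value such that 2·θ(λ,1) < k·θ*(λ) for 0 < λ < λ*_{k,1} and 2·θ(λ,1) > k·θ*(λ) for λ*_{k,1} < λ < λ̂. Then the sequence (λ*_{k,1})_{k ≥ 3} is strictly increasing in k and λ*_{k,1} → λ̂ as k → ∞. -/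
open MeasureTheory Filter Set

/-- A solution `g` of `f (g x) = c x` with `f` strictly monotone on an open set and `c` continuous
is continuous. -/
theorem continuousAt_of_strictMonoOn_comp {f g c : ℝ → ℝ} {S : Set ℝ} {x₀ : ℝ}
    (hS : IsOpen S) (hf : StrictMonoOn f S) (hg : ∀ᶠ x in nhds x₀, g x ∈ S)
    (hc : ContinuousAt c x₀) (hfg : ∀ᶠ x in nhds x₀, f (g x) = c x) :
    ContinuousAt g x₀ := by
  have hg₀ := hg.self_of_nhds
  have hfg₀ := hfg.self_of_nhds
  have hnhds : ∀ᶠ y in nhds (g x₀), y ∈ S := hS.mem_nhds hg₀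
  refine tendsto_order.2 ⟨fun a ha => ?_, fun b hb => ?_⟩
  · obtain ⟨a', ha'S, ha'⟩ :=
      ((hnhds.filter_mono nhdsWithin_le_nhds).and (Ioo_mem_nhdsLT ha)).exists
    have hlt : f a' < c x₀ := hfg₀ ▸ hf ha'S hg₀ ha'.2
    filter_upwards [hg, hfg, hc.eventually (lt_mem_nhds hlt)] with x hx hx' hx''
    exact ha'.1.trans ((hf.lt_iff_lt ha'S hx).1 (hx' ▸ hx''))
  · obtain ⟨b', hb'S, hb'⟩ :=
      ((hnhds.filter_mono nhdsWithin_le_nhds).and (Ioo_mem_nhdsGT hb)).exists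
    have hlt : c x₀ < f b' := hfg₀ ▸ hf hg₀ hb'S hb'.1
    filter_upwards [hg, hfg, hc.eventually (gt_mem_nhds hlt)] with x hx hx' hx''
    exact ((hf.lt_iff_lt hx hb'S).1 (hx' ▸ hx'')).trans hb'.2

/-- The slope at the origin of `θ ↦ exp (θ * x)` is strictly increasing when `x > 0`. -/
theorem exp_mul_sub_one_div_lt {a b x : ℝ} (ha : 0 < a) (hab : a < b) (hx : 0 < x) :
    (Real.exp (a * x) - 1) / a < (Real.exp (b * x) - 1) / b := by
  have hax : 0 < a * x := mul_pos ha hx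
  have habx : a * x < b * x := mul_lt_mul_of_pos_right hab hx
  have h := strictConvexOn_exp.secant_strict_mono (mem_univ 0) (mem_univ (a * x))
    (mem_univ (b * x)) hax.ne' (hax.trans habx).ne' habx
  simp only [Real.exp_zero, sub_zero, ← div_div, div_right_comm _ _ x] at h
  have hlt := mul_lt_mul_of_pos_right h hx
  have hb : b ≠ 0 := (ha.trans hab).ne'
  have ha' := ha.ne'
  have hx' := hx.ne'
  field_simp at hlt ⊢
  exact hlt

/-- The slope at the origin of the moment generating function of a nonnegative random variable
that is not almost surely zero is strictly increasing. -/
theorem strictMonoOn_slope_integral_exp {Ω : Type*} [MeasurableSpace Ω] {μ : Measure Ω}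
    [IsProbabilityMeasure μ] {ξ : Ω → ℝ} {S : Set ℝ} (hS : S ⊆ Ioi 0)
    (hnn : ∀ᵐ ω ∂μ, 0 ≤ ξ ω) (hpp : 0 < μ {ω | 0 < ξ ω})
    (hint : ∀ θ ∈ S, Integrable (fun ω => Real.exp (θ * ξ ω)) μ) :
    StrictMonoOn (fun θ => ((∫ ω, Real.exp (θ * ξ ω) ∂μ) - 1) / θ) S := by
  have hslope : ∀ θ ∈ S, Integrable (fun ω => (Real.exp (θ * ξ ω) - 1) / θ) μ ∧
      ∫ ω, (Real.exp (θ * ξ ω) - 1) / θ ∂μ = ((∫ ω, Real.exp (θ * ξ ω) ∂μ) - 1) / θ := by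
    intro θ hθ
    refine ⟨((hint θ hθ).sub (integrable_const 1)).div_const θ, ?_⟩
    rw [integral_div, integral_sub (hint θ hθ) (integrable_const 1)]
    simp
  intro a ha b hb hab
  obtain ⟨hia, hea⟩ := hslope a ha
  obtain ⟨hib, heb⟩ := hslope b hb
  simp only [← hea, ← heb]
  rw [← sub_pos, ← integral_sub hib hia]
  refine (integral_pos_iff_support_of_nonneg_ae ?_ (hib.sub hia)).2 ?_
  · filter_upwards [hnn] with ω hω
    rcases hω.eq_or_lt with h | h
    · simp [← h]
    · exact (sub_pos.2 (exp_mul_sub_one_div_lt (hS ha) hab h)).le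
  · refine hpp.trans_le (measure_mono fun ω hω => ?_)
    exact (sub_pos.2 (exp_mul_sub_one_div_lt (hS ha) hab hω)).ne'

/-- convergence of the critical rate: the thresholds λ*_{k,1} are
strictly increasing in k and tend to λ̂ as k → ∞. -/
theorem stmt_12
    {Ω : Type*} [MeasurableSpace Ω] (μ : Measure Ω) [IsProbabilityMeasure μ]
    (ξ : Ω → ℝ) (hmeas : Measurable ξ)
    (hnn : ∀ᵐ ω ∂μ, 0 ≤ ξ ω)
    (hint : Integrable ξ μ)
    (hmean : 0 < ∫ ω, ξ ω ∂μ)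
    (hpp : 0 < μ {ω | 0 < ξ ω})
    (θp : EReal) (hθp : 0 < θp)
    (φ : ℝ → ℝ) (hφ : ∀ θ : ℝ, φ θ = ∫ ω, Real.exp (θ * ξ ω) ∂μ)
    (hfin : ∀ θ : ℝ, (θ : EReal) < θp →
      Integrable (fun ω => Real.exp (θ * ξ ω)) μ)
    (hblow : ∀ t : ℝ, θp = (t : EReal) →
      Filter.Tendsto φ (nhdsWithin t (Set.Iio t)) Filter.atTop)
    (lamhat : ℝ) (hlamhat : lamhat = 1 / deriv φ 0)
    (θ1 : ℝ → ℝ)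
    (hθ1 : ∀ lam : ℝ, 0 < lam → lam < 2 * lamhat →
      (0 < θ1 lam ∧ (θ1 lam : EReal) < θp) ∧
        2 * θ1 lam = lam * (φ (θ1 lam) - 1))
    (θS : ℝ → ℝ)
    (hθS : ∀ lam : ℝ, 0 < lam → lam < lamhat →
      (0 < θS lam ∧ (θS lam : EReal) < θp) ∧
        θS lam = lam * (φ (θS lam) - 1))
    (lamstar : ℕ → ℝ)
    (hls : ∀ k : ℕ, 3 ≤ k →
      (0 < lamstar k ∧ lamstar k < lamhat) ∧
      (∀ lam : ℝ, 0 < lam → lam < lamstar k →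
        2 * θ1 lam < (k : ℝ) * θS lam) ∧
      (∀ lam : ℝ, lamstar k < lam → lam < lamhat →
        (k : ℝ) * θS lam < 2 * θ1 lam)) :
    (∀ k : ℕ, 3 ≤ k → lamstar k < lamstar (k + 1)) ∧
    Filter.Tendsto lamstar Filter.atTop (nhds lamhat) := by
  let S : Set ℝ := {θ | 0 < θ ∧ (θ : EReal) < θp}
  have hS : IsOpen S := (isOpen_lt continuous_const continuous_id).inter
    (isOpen_lt continuous_coe_real_ereal continuous_const)
  have hmono : StrictMonoOn (fun θ => (φ θ - 1) / θ) S := by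
    simp only [hφ]
    exact strictMonoOn_slope_integral_exp (fun θ hθ => hθ.1) hnn hpp fun θ hθ => hfin θ hθ.2
  have hcont1 : ∀ lam, 0 < lam → lam < lamhat → ContinuousAt θ1 lam := by
    intro lam h0 h1
    have hnhds := Ioo_mem_nhds h0 (show lam < 2 * lamhat by linarith)
    refine continuousAt_of_strictMonoOn_comp (c := fun x => 2 / x) hS hmono ?_
      (continuousAt_const.div continuousAt_id h0.ne') ?_
    · filter_upwards [hnhds] with x hx using (hθ1 x hx.1 hx.2).1
    · filter_upwards [hnhds] with x hx
      obtain ⟨⟨hpos, -⟩, heq⟩ := hθ1 x hx.1 hx.2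
      rw [div_eq_div_iff hpos.ne' hx.1.ne', heq, mul_comm]
  have hcontS : ∀ lam, 0 < lam → lam < lamhat → ContinuousAt θS lam := by
    intro lam h0 h1
    have hnhds := Ioo_mem_nhds h0 h1
    refine continuousAt_of_strictMonoOn_comp (c := fun x => 1 / x) hS hmono ?_
      (continuousAt_const.div continuousAt_id h0.ne') ?_
    · filter_upwards [hnhds] with x hx using (hθS x hx.1 hx.2).1
    · filter_upwards [hnhds] with x hx
      obtain ⟨⟨hpos, -⟩, heq⟩ := hθS x hx.1 hx.2
      rw [div_eq_div_iff hpos.ne' hx.1.ne', one_mul, mul_comm, ← heq]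
  have hstar : ∀ k : ℕ, 3 ≤ k → 2 * θ1 (lamstar k) = (k : ℝ) * θS (lamstar k) := by
    intro k hk
    obtain ⟨⟨h0, h1⟩, hlt, hgt⟩ := hls k hk
    have hc1 : Tendsto (fun x => 2 * θ1 x) (nhds (lamstar k)) (nhds (2 * θ1 (lamstar k))) :=
      (hcont1 _ h0 h1).const_mul 2
    have hcS : Tendsto (fun x => (k : ℝ) * θS x) (nhds (lamstar k))
        (nhds (k * θS (lamstar k))) := (hcontS _ h0 h1).const_mul (k : ℝ)
    apply le_antisymm
    · refine le_of_tendsto_of_tendsto (hc1.mono_left (nhdsWithin_le_nhds (s := Iio (lamstar k))))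
        (hcS.mono_left nhdsWithin_le_nhds) ?_
      filter_upwards [Ioo_mem_nhdsLT h0] with x hx using (hlt x hx.1 hx.2).le
    · refine le_of_tendsto_of_tendsto (hcS.mono_left (nhdsWithin_le_nhds (s := Ioi (lamstar k))))
        (hc1.mono_left nhdsWithin_le_nhds) ?_
      filter_upwards [Ioo_mem_nhdsGT h1] with x hx using (hgt x hx.1 hx.2).le
  constructor
  · intro k hk
    obtain ⟨⟨h0, h1⟩, -, -⟩ := hls k hk
    have hpos := (hθS _ h0 h1).1.1
    have heq := hstar k hk
    by_contra! hle
    rcases hle.eq_or_lt with h | h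
    · have heq' := hstar (k + 1) (by omega)
      rw [h] at heq'
      push_cast at heq'
      linarith
    · have hlt := (hls (k + 1) (by omega)).2.2 _ h h1
      push_cast at hlt
      linarith
  · refine tendsto_order.2 ⟨fun a ha => ?_, fun b hb => ?_⟩
    · have hpos : 0 < lamhat := (hls 3 le_rfl).1.1.trans (hls 3 le_rfl).1.2
      obtain ⟨lam, hlam, hlam'⟩ := exists_between (max_lt ha hpos)
      obtain ⟨hal, h0⟩ := max_lt_iff.1 hlam
      have hS0 := (hθS lam h0 hlam').1.1
      filter_upwards [eventually_ge_atTop 3,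
        tendsto_natCast_atTop_atTop.eventually_gt_atTop (2 * θ1 lam / θS lam)] with k hk hk'
      rw [div_lt_iff₀ hS0] at hk'
      by_contra! hle
      exact hk'.not_gt ((hls k hk).2.2 lam (hle.trans_lt hal) hlam')
    · filter_upwards [eventually_ge_atTop 3] with k hk using (hls k hk).1.2.trans hb
end

section
/- (Proposition 2.) Suppose there exist an integer l > 1 and λ₀ with 0 < λ₀ ≤ λ̂ such that (l+1)·θ(λ₀,l) < 2·θ(λ₀,1). Then for every sufficiently large integer k (in particular k > l) there exists λ with 0 < λ < λ̂ such that (l+1)·θ(λ,l) < 2·θ(λ,1) and (l+1)·θ(λ,l) < k·θ*(λ); consequently for such k the thresholds satisfy λ_k < λ^k, i.e. for this λ the minimum of the decay rates J(λ,m) over 1 ≤ m ≤ k is achieved neither at m = 1 nor at m = k. -/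
open MeasureTheory Filter Set

lemma mul_exp_sub_one_lt_mul_exp_sub_one {s t x : ℝ} (hs : 0 < s) (hst : s < t) (hx : x ≠ 0) :
    t * (Real.exp (s * x) - 1) < s * (Real.exp (t * x) - 1) := by
  have ht : 0 < t := hs.trans hst
  have h := strictConvexOn_exp.2 (mem_univ (t * x)) (mem_univ 0)
    (mul_ne_zero ht.ne' hx) (div_pos hs ht) (sub_pos.2 ((div_lt_one ht).2 hst))
    (by ring)
  have e : (s / t) • (t * x) + (1 - s / t) • (0 : ℝ) = s * x := by
    simp only [smul_eq_mul]
    field_simp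
    ring
  rw [e] at h
  simp only [smul_eq_mul, Real.exp_zero] at h
  have h' := mul_lt_mul_of_pos_left h ht
  have e' : t * (s / t * Real.exp (t * x) + (1 - s / t) * 1) = s * Real.exp (t * x) + (t - s) := by
    field_simp
  linarith

/-- The secant slope `(mgf θ - 1) / θ` of the moment generating function of a random variable
that is positive with positive probability is strictly increasing in `θ > 0`. -/
lemma mul_integral_exp_sub_one_lt {Ω : Type*} [MeasurableSpace Ω] {μ : Measure Ω}
    [IsProbabilityMeasure μ] {ξ : Ω → ℝ} (hpp : 0 < μ {ω | 0 < ξ ω})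
    {s t : ℝ} (hs : 0 < s) (hst : s < t)
    (his : Integrable (fun ω => Real.exp (s * ξ ω)) μ)
    (hit : Integrable (fun ω => Real.exp (t * ξ ω)) μ) :
    t * (∫ ω, Real.exp (s * ξ ω) ∂μ - 1) < s * (∫ ω, Real.exp (t * ξ ω) ∂μ - 1) := by
  have is' : Integrable (fun ω => t * (Real.exp (s * ξ ω) - 1)) μ :=
    (his.sub (integrable_const (1 : ℝ))).const_mul t
  have it' : Integrable (fun ω => s * (Real.exp (t * ξ ω) - 1)) μ :=
    (hit.sub (integrable_const (1 : ℝ))).const_mul s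
  have hpos : 0 < ∫ ω, (s * (Real.exp (t * ξ ω) - 1) - t * (Real.exp (s * ξ ω) - 1)) ∂μ := by
    refine (integral_pos_iff_support_of_nonneg ?_ (it'.sub is')).2 ?_
    · intro ω
      rcases eq_or_ne (ξ ω) 0 with h | h
      · simp [h]
      · exact (sub_pos.2 (mul_exp_sub_one_lt_mul_exp_sub_one hs hst h)).le
    · refine hpp.trans_le (measure_mono fun ω hω => ?_)
      exact (sub_pos.2 (mul_exp_sub_one_lt_mul_exp_sub_one hs hst (ne_of_gt hω))).ne'
  have e : ∫ ω, (s * (Real.exp (t * ξ ω) - 1) - t * (Real.exp (s * ξ ω) - 1)) ∂μ =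
      s * (∫ ω, Real.exp (t * ξ ω) ∂μ - 1) - t * (∫ ω, Real.exp (s * ξ ω) ∂μ - 1) := by
    rw [integral_sub it' is', integral_const_mul, integral_const_mul,
      integral_sub hit (integrable_const _), integral_sub his (integrable_const _)]
    simp
  linarith

/-- Proposition 2: if (l+1)·θ(λ₀,l) < 2·θ(λ₀,1) for some l > 1 and
some λ₀ ∈ (0,λ̂], then for all sufficiently large k there is λ ∈ (0,λ̂) at which the
rate (l+1)·θ(λ,l) is smaller than both 2·θ(λ,1) and k·θ*(λ); hence the minimum of
the decay rates J(λ,m) over 1 ≤ m ≤ k is achieved neither at m = 1 nor at m = k. -/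
theorem stmt_13
    {Ω : Type*} [MeasurableSpace Ω] (μ : Measure Ω) [IsProbabilityMeasure μ]
    (ξ : Ω → ℝ) (hmeas : Measurable ξ)
    (hnn : ∀ᵐ ω ∂μ, 0 ≤ ξ ω)
    (hint : Integrable ξ μ)
    (hmean : 0 < ∫ ω, ξ ω ∂μ)
    (hpp : 0 < μ {ω | 0 < ξ ω})
    (θp : EReal) (hθp : 0 < θp)
    (φ : ℝ → ℝ) (hφ : ∀ θ : ℝ, φ θ = ∫ ω, Real.exp (θ * ξ ω) ∂μ)
    (hfin : ∀ θ : ℝ, (θ : EReal) < θp →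
      Integrable (fun ω => Real.exp (θ * ξ ω)) μ)
    (hblow : ∀ t : ℝ, θp = (t : EReal) →
      Filter.Tendsto φ (nhdsWithin t (Set.Iio t)) Filter.atTop)
    (lamhat : ℝ) (hlamhat : lamhat = 1 / deriv φ 0)
    (θL : ℕ → ℝ → ℝ)
    (hθL : ∀ m : ℕ, 1 ≤ m → ∀ lam : ℝ, 0 < lam →
      lam < ((m : ℝ) + 1) / (m : ℝ) * lamhat →
      (0 < θL m lam ∧ (θL m lam : EReal) < θp) ∧
        ((m : ℝ) + 1) * θL m lam = (m : ℝ) * lam * (φ (θL m lam) - 1))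
    (θS : ℝ → ℝ)
    (hθS : ∀ lam : ℝ, 0 < lam → lam < lamhat →
      (0 < θS lam ∧ (θS lam : EReal) < θp) ∧
        θS lam = lam * (φ (θS lam) - 1))
    (l : ℕ) (hl : 1 < l) (lam0 : ℝ) (h00 : 0 < lam0) (h01 : lam0 ≤ lamhat)
    (hyp : ((l : ℝ) + 1) * θL l lam0 < 2 * θL 1 lam0) :
    ∃ K : ℕ, ∀ k : ℕ, K ≤ k → l < k ∧
      ∃ lam : ℝ, 0 < lam ∧ lam < lamhat ∧
        ((l : ℝ) + 1) * θL l lam < 2 * θL 1 lam ∧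
        ((l : ℝ) + 1) * θL l lam < (k : ℝ) * θS lam := by
  have slope : ∀ s t : ℝ, 0 < s → s < t → (t : EReal) < θp →
      t * (φ s - 1) < s * (φ t - 1) := by
    intro s t hs hst ht
    rw [hφ, hφ]
    exact mul_integral_exp_sub_one_lt hpp hs hst
      (hfin s ((EReal.coe_lt_coe_iff.2 hst).trans ht)) (hfin t ht)
  have hl' : (1 : ℝ) < l := by exact_mod_cast hl
  have hhat : 0 < lamhat := h00.trans_le h01
  have lt_range : ∀ m : ℕ, 1 ≤ m → ∀ lam : ℝ, lam ≤ lamhat →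
      lam < ((m : ℝ) + 1) / (m : ℝ) * lamhat := by
    intro m hm lam hlam
    have hm' : (0 : ℝ) < m := by exact_mod_cast hm
    have h1 : 1 < ((m : ℝ) + 1) / m := (one_lt_div hm').2 (by linarith)
    nlinarith
  obtain ⟨lam, hlam, hlamlt, hlt⟩ : ∃ lam : ℝ, 0 < lam ∧ lam < lamhat ∧
      ((l : ℝ) + 1) * θL l lam < 2 * θL 1 lam := by
    obtain ⟨⟨ha, haθ⟩, ea⟩ := hθL l hl.le lam0 h00 (lt_range l hl.le _ h01)
    obtain ⟨⟨hb, hbθ⟩, eb⟩ := hθL 1 le_rfl lam0 h00 (lt_range 1 le_rfl _ h01)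
    set a := θL l lam0
    set b := θL 1 lam0
    obtain ⟨c, hac, hcb⟩ : ∃ c, a < c ∧ c < 2 * b / ((l : ℝ) + 1) :=
      exists_between ((lt_div_iff₀ (by linarith)).2 (by linarith))
    rw [lt_div_iff₀ (by linarith)] at hcb
    have hc : 0 < c := ha.trans hac
    have hcb' : c < b := by nlinarith
    have hcθ : (c : EReal) < θp := (EReal.coe_lt_coe_iff.2 hcb').trans hbθ
    have hφc : ((l : ℝ) + 1) * c < l * lam0 * (φ c - 1) := by
      have h := mul_lt_mul_of_pos_left (slope a c ha hac hcθ) (by positivity : 0 < (l : ℝ) * lam0)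
      refine lt_of_mul_lt_mul_left (a := a) ?_ ha.le
      linear_combination h + c * ea
    have hφc1 : 0 < φ c - 1 :=
      pos_of_mul_pos_right (lt_trans (by positivity) hφc) (by positivity)
    obtain ⟨lam, hlow, hlam0⟩ : ∃ lam, ((l : ℝ) + 1) * c / (l * (φ c - 1)) < lam ∧ lam < lam0 :=
      exists_between ((div_lt_iff₀ (by positivity)).2 (by linarith))
    have hlam : 0 < lam := lt_trans (by positivity) hlow
    rw [div_lt_iff₀ (by positivity)] at hlow
    have hlamhat' : lam < lamhat := hlam0.trans_le h01
    refine ⟨lam, hlam, hlamhat', ?_⟩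
    obtain ⟨⟨hs, hsθ⟩, es⟩ := hθL l hl.le lam hlam (lt_range l hl.le _ hlamhat'.le)
    obtain ⟨⟨ht, -⟩, et⟩ := hθL 1 le_rfl lam hlam (lt_range 1 le_rfl _ hlamhat'.le)
    have hsc : θL l lam < c := by
      by_contra! hcs
      rcases hcs.eq_or_lt with h | h
      · rw [← h] at es
        linarith
      · have h1 := mul_lt_mul_of_pos_left (slope c _ hc h hsθ) (by positivity : 0 < (l : ℝ) * lam)
        have h2 := mul_lt_mul_of_pos_left hlow hs
        have h3 : (0 : ℝ) < 0 := by linear_combination h1 + h2 - c * es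
        exact h3.false
    have hbt : b ≤ θL 1 lam := by
      by_contra! h
      have h1 := mul_lt_mul_of_pos_left (slope _ b ht h hbθ) (mul_pos hlam h00)
      have h2 : 0 < θL 1 lam * b := by positivity
      push_cast at et eb
      have h3 : lam0 * (θL 1 lam * b) < lam * (θL 1 lam * b) := by
        linear_combination h1 / 2 + lam0 * b * et / 2 - lam * θL 1 lam * eb / 2
      exact absurd (lt_of_mul_lt_mul_right h3 h2.le) hlam0.not_gt
    nlinarith
  obtain ⟨⟨hS, -⟩, -⟩ := hθS lam hlam hlamlt
  obtain ⟨N, hN⟩ := exists_nat_gt (((l : ℝ) + 1) * θL l lam / θS lam)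
  refine ⟨max N (l + 1), fun k hk => ⟨by omega, lam, hlam, hlamlt, hlt, ?_⟩⟩
  rw [← div_lt_iff₀ hS]
  exact hN.trans_le (by exact_mod_cast (le_max_left _ _).trans hk)
end

section
/- (Example 2: hyperexponential message lengths, explicit roots.) Let 0 < g < c and φ(θ) = 1 + θ·(c − θ)/((c − θ)² − g²) for θ < c − g, and set λ̂ = (c² − g²)/c. Then for every integer l ≥ 1 and every λ with 0 < λ ≤ λ̂, the number θ = c − λ·l/(2·(l+1)) − sqrt(λ²·l²/(4·(l+1)²) + g²) lies in (0, c − g) and is the unique root in (0, c − g) of (l+1)·θ = l·λ·(φ(θ) − 1); equivalently, ϑ_l(λ) := (l+1)·θ(λ,l) = c + l·(c − λ/2 − sqrt(λ²/4 + g²·(l+1)²/l²)). -/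
open Filter Set

/-- The positive root of `u ^ 2 - 2 * a * u - g ^ 2`. -/
lemma eq_add_sqrt_iff_of_pos {a g u : ℝ} (hg : 0 < g) (hu : 0 < u) :
    u = a + Real.sqrt (a ^ 2 + g ^ 2) ↔ u ^ 2 - g ^ 2 = 2 * a * u := by
  have hs : Real.sqrt (a ^ 2 + g ^ 2) ^ 2 = a ^ 2 + g ^ 2 := Real.sq_sqrt (by positivity)
  have hs0 : a < Real.sqrt (a ^ 2 + g ^ 2) := Real.lt_sqrt_of_sq_lt (by nlinarith)
  constructor
  · intro h
    rw [h]
    linear_combination hs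
  · intro h
    have hmul : (u - a - Real.sqrt (a ^ 2 + g ^ 2)) * (u - a + Real.sqrt (a ^ 2 + g ^ 2)) = 0 := by
      linear_combination h - hs
    rcases mul_eq_zero.mp hmul with h | h <;> linarith

/-- The positive root of `u ^ 2 - 2 * a * u - g ^ 2` lies strictly between `g` and `c` when
the polynomial is positive at `c`. -/
lemma add_sqrt_mem_Ioo {a g c : ℝ} (ha : 0 < a) (hc : 0 < c)
    (h : 2 * a * c < c ^ 2 - g ^ 2) :
    a + Real.sqrt (a ^ 2 + g ^ 2) ∈ Set.Ioo g c := by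
  have hac : a < c := by nlinarith
  have hgs : g ≤ Real.sqrt (a ^ 2 + g ^ 2) := Real.le_sqrt_of_sq_le (by nlinarith)
  have hsc : Real.sqrt (a ^ 2 + g ^ 2) < c - a :=
    (Real.sqrt_lt' (by linarith)).mpr (by nlinarith)
  exact ⟨by linarith, by linarith⟩

/-- Example 2: hyperexponential message lengths, explicit roots. -/
theorem stmt_16 (c g : ℝ) (hg : 0 < g) (hgc : g < c)
    (φ : ℝ → ℝ)
    (hφ : ∀ θ : ℝ, θ < c - g → φ θ = 1 + θ * (c - θ) / ((c - θ)^2 - g^2))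
    (lamhat : ℝ) (hlamhat : lamhat = (c^2 - g^2) / c) :
    ∀ l : ℕ, 1 ≤ l → ∀ lam : ℝ, 0 < lam → lam ≤ lamhat →
      (c - lam * (l : ℝ) / (2 * ((l : ℝ) + 1))
          - Real.sqrt (lam^2 * (l : ℝ)^2 / (4 * ((l : ℝ) + 1)^2) + g^2))
        ∈ Set.Ioo (0 : ℝ) (c - g) ∧
      (∀ θ : ℝ, θ ∈ Set.Ioo (0 : ℝ) (c - g) →
        (((l : ℝ) + 1) * θ = (l : ℝ) * lam * (φ θ - 1) ↔
          θ = c - lam * (l : ℝ) / (2 * ((l : ℝ) + 1))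
              - Real.sqrt (lam^2 * (l : ℝ)^2 / (4 * ((l : ℝ) + 1)^2) + g^2))) ∧
      ((l : ℝ) + 1) * (c - lam * (l : ℝ) / (2 * ((l : ℝ) + 1))
          - Real.sqrt (lam^2 * (l : ℝ)^2 / (4 * ((l : ℝ) + 1)^2) + g^2))
        = c + (l : ℝ) * (c - lam / 2
            - Real.sqrt (lam^2 / 4 + g^2 * ((l : ℝ) + 1)^2 / (l : ℝ)^2)) := by
  intro l hl lam hlam hle
  have hl0 : (0 : ℝ) < l := by exact_mod_cast hl
  have hc : 0 < c := hg.trans hgc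
  have hsqrt : Real.sqrt (lam^2 / 4 + g^2 * ((l : ℝ) + 1)^2 / (l : ℝ)^2)
      = ((l : ℝ) + 1) / l *
        Real.sqrt (lam^2 * (l : ℝ)^2 / (4 * ((l : ℝ) + 1)^2) + g^2) := by
    rw [← Real.sqrt_sq (by positivity : 0 ≤ ((l : ℝ) + 1) / l),
      ← Real.sqrt_mul (by positivity)]
    congr 1
    field_simp
  have hsq : lam^2 * (l : ℝ)^2 / (4 * ((l : ℝ) + 1)^2)
      = (lam * (l : ℝ) / (2 * ((l : ℝ) + 1))) ^ 2 := by
    field_simp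
    norm_num
  have ha : 0 < lam * (l : ℝ) / (2 * ((l : ℝ) + 1)) := by positivity
  have hal : 2 * ((l : ℝ) + 1) * (lam * (l : ℝ) / (2 * ((l : ℝ) + 1))) = l * lam := by
    field_simp
  have hlamc : lam * c ≤ c ^ 2 - g ^ 2 := by
    rwa [hlamhat, le_div_iff₀ hc] at hle
  rw [hsqrt, hsq]
  set a := lam * (l : ℝ) / (2 * ((l : ℝ) + 1))
  have hac : 2 * a * c < c ^ 2 - g ^ 2 := by
    have h2a : 2 * a < lam := by
      by_contra! h
      nlinarith
    nlinarith
  refine ⟨?_, ?_, ?_⟩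
  · obtain ⟨h1, h2⟩ := add_sqrt_mem_Ioo ha hc hac
    exact ⟨by linarith, by linarith⟩
  · rintro θ ⟨hθ0, hθ⟩
    have hu : 0 < c - θ := by linarith
    have hden : 0 < (c - θ) ^ 2 - g ^ 2 := by nlinarith
    have hroot : θ = c - a - Real.sqrt (a ^ 2 + g ^ 2) ↔ (c - θ) ^ 2 - g ^ 2 = 2 * a * (c - θ) := by
      rw [← eq_add_sqrt_iff_of_pos hg hu]
      constructor <;> intro h <;> linarith
    rw [hroot, hφ θ hθ, add_sub_cancel_left, ← mul_div_assoc, eq_div_iff hden.ne', ← hal]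
    have hne : ((l : ℝ) + 1) * θ ≠ 0 := by positivity
    constructor
    · intro h
      exact mul_left_cancel₀ hne (by linear_combination h)
    · intro h
      linear_combination ((l : ℝ) + 1) * θ * h
  · have hcancel : (l : ℝ) * (((l : ℝ) + 1) / l * Real.sqrt (a ^ 2 + g ^ 2))
        = ((l : ℝ) + 1) * Real.sqrt (a ^ 2 + g ^ 2) := by
      field_simp
    linear_combination hcancel - hal / 2
end

section
/- (Example 2: hyperexponential message lengths, monotonicity in the number of overheated flows.) Let 0 < g < c, φ(θ) = 1 + θ·(c − θ)/((c − θ)² − g²) for θ < c − g, and λ̂ = (c² − g²)/c. Then for every λ with 0 < λ ≤ λ̂ the sequence l ↦ ϑ_l(λ) = (l+1)·θ(λ,l) = c + l·(c − λ/2 − sqrt(λ²/4 + g²·(l+1)²/l²)) is strictly increasing in the integer l ≥ 1. Consequently, for every λ ∈ (0, λ̂) and all 1 ≤ l₁ < l₂ one has (l₁+1)·θ(λ,l₁) < (l₂+1)·θ(λ,l₂), i.e. the pairwise crossing points λ_{l₂,l₁} all exceed λ̂ and hence λ_k = λ^k for every k ≥ 3. -/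
open Filter Set

/-- A strict triangle inequality in the plane, for the vectors `(a * p, g * (a + 1))` and
`(b - a) • (p, g)`. -/
theorem sqrt_sq_add_lt_sqrt_add_mul_sqrt {p g a b : ℝ} (hp : 0 < p) (hg : 0 < g) (hab : a < b) :
    √((b * p) ^ 2 + (g * (b + 1)) ^ 2) <
      √((a * p) ^ 2 + (g * (a + 1)) ^ 2) + (b - a) * √(p ^ 2 + g ^ 2) := by
  set A := √((a * p) ^ 2 + (g * (a + 1)) ^ 2)
  set S := √(p ^ 2 + g ^ 2)
  have hA : A ^ 2 = (a * p) ^ 2 + (g * (a + 1)) ^ 2 := Real.sq_sqrt (by positivity)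
  have hS : S ^ 2 = p ^ 2 + g ^ 2 := Real.sq_sqrt (by positivity)
  have hS0 : 0 < S := Real.sqrt_pos.2 (by positivity)
  have hA0 : 0 ≤ A := Real.sqrt_nonneg _
  have hd : 0 < b - a := sub_pos.2 hab
  have hCS : a * p ^ 2 + g ^ 2 * (a + 1) < A * S := by
    apply lt_of_pow_lt_pow_left₀ 2 (by positivity)
    have hpg : 0 < (p * g) ^ 2 := by positivity
    rw [mul_pow, hA, hS]
    linarith
  rw [Real.sqrt_lt' (by positivity)]
  have h := mul_lt_mul_of_pos_left hCS hd
  calc (b * p) ^ 2 + (g * (b + 1)) ^ 2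
      = A ^ 2 + 2 * ((b - a) * (a * p ^ 2 + g ^ 2 * (a + 1))) + (b - a) ^ 2 * S ^ 2 := by
        rw [hA, hS]; ring
    _ < A ^ 2 + 2 * ((b - a) * (A * S)) + (b - a) ^ 2 * S ^ 2 := by linarith
    _ = (A + (b - a) * S) ^ 2 := by ring

theorem mul_sqrt_sq_div_four_add {lam g l : ℝ} (hl : 0 < l) :
    l * √(lam ^ 2 / 4 + g ^ 2 * (l + 1) ^ 2 / l ^ 2) =
      √((l * (lam / 2)) ^ 2 + (g * (l + 1)) ^ 2) := by
  symm
  rw [Real.sqrt_eq_iff_mul_self_eq (by positivity) (by positivity), mul_mul_mul_comm,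
    Real.mul_self_sqrt (by positivity)]
  field_simp
  ring

theorem add_mul_sub_sqrt_lt_add_mul_sub_sqrt {c g lam a b : ℝ} (hg : 0 < g) (hgc : g < c)
    (hlam : 0 < lam)
    (hle : lam ≤ (c ^ 2 - g ^ 2) / c) (ha : 0 < a) (hab : a < b) :
    c + a * (c - lam / 2 - √(lam ^ 2 / 4 + g ^ 2 * (a + 1) ^ 2 / a ^ 2)) <
      c + b * (c - lam / 2 - √(lam ^ 2 / 4 + g ^ 2 * (b + 1) ^ 2 / b ^ 2)) := by
  have hc : 0 < c := hg.trans hgc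
  rw [le_div_iff₀ hc] at hle
  have hS : √((lam / 2) ^ 2 + g ^ 2) ≤ c - lam / 2 :=
    Real.sqrt_le_iff.2 ⟨by nlinarith, by nlinarith⟩
  have htri := sqrt_sq_add_lt_sqrt_add_mul_sqrt (half_pos hlam) hg hab
  have hslope := mul_le_mul_of_nonneg_left hS (sub_pos.2 hab).le
  rw [mul_sub a, mul_sub b, mul_sqrt_sq_div_four_add ha, mul_sqrt_sq_div_four_add (ha.trans hab)]
  linarith

/-- The closed form of the root of `(l + 1) * θ = l * lam * (φ θ - 1)`. -/
theorem add_one_mul_root_eq {c g lam l θ : ℝ} (hg : 0 < g) (hl : 0 < l)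
    (hθ : 0 < θ) (hθc : θ < c - g)
    (h : (l + 1) * θ = l * lam * (θ * (c - θ) / ((c - θ) ^ 2 - g ^ 2))) :
    (l + 1) * θ = c + l * (c - lam / 2 - √(lam ^ 2 / 4 + g ^ 2 * (l + 1) ^ 2 / l ^ 2)) := by
  obtain ⟨u, rfl⟩ : ∃ u, θ = c - u := ⟨c - θ, by ring⟩
  rw [sub_sub_cancel] at h
  have hgu : g < u := by linarith
  have hu : 0 < u := hg.trans hgu
  have hden : 0 < u ^ 2 - g ^ 2 := by nlinarith
  have hquad : (l + 1) * (u ^ 2 - g ^ 2) = l * lam * u := by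
    rw [mul_div_assoc', eq_div_iff hden.ne'] at h
    apply mul_left_cancel₀ hθ.ne'
    linarith
  have hpos : 0 ≤ (l + 1) * u - l * lam / 2 := by
    have h2 : 0 < (l + 1) * (u ^ 2 + g ^ 2) := by positivity
    refine (pos_of_mul_pos_left (b := 2 * u) ?_ (by positivity)).le
    linarith
  have hsqrt : √((l * (lam / 2)) ^ 2 + (g * (l + 1)) ^ 2) = (l + 1) * u - l * lam / 2 := by
    rw [Real.sqrt_eq_iff_mul_self_eq (by positivity) hpos]
    linear_combination -(l + 1) * hquad
  rw [mul_sub l, mul_sqrt_sq_div_four_add hl, hsqrt]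
  ring

/-- Example 2: hyperexponential message lengths, monotonicity in the
number of overheated flows. -/
theorem stmt_17 (c g : ℝ) (hg : 0 < g) (hgc : g < c)
    (φ : ℝ → ℝ)
    (hφ : ∀ θ : ℝ, θ < c - g → φ θ = 1 + θ * (c - θ) / ((c - θ)^2 - g^2))
    (lamhat : ℝ) (hlamhat : lamhat = (c^2 - g^2) / c)
    (θL : ℕ → ℝ → ℝ)
    (hθL : ∀ l : ℕ, 1 ≤ l → ∀ lam : ℝ, 0 < lam →
      lam < ((l : ℝ) + 1) / (l : ℝ) * lamhat →
      θL l lam ∈ Set.Ioo (0 : ℝ) (c - g) ∧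
        ((l : ℝ) + 1) * θL l lam = (l : ℝ) * lam * (φ (θL l lam) - 1)) :
    (∀ lam : ℝ, 0 < lam → lam ≤ lamhat → ∀ l₁ l₂ : ℕ, 1 ≤ l₁ → l₁ < l₂ →
      c + (l₁ : ℝ) * (c - lam / 2
          - Real.sqrt (lam^2 / 4 + g^2 * ((l₁ : ℝ) + 1)^2 / (l₁ : ℝ)^2)) <
      c + (l₂ : ℝ) * (c - lam / 2
          - Real.sqrt (lam^2 / 4 + g^2 * ((l₂ : ℝ) + 1)^2 / (l₂ : ℝ)^2))) ∧
    (∀ lam : ℝ, 0 < lam → lam < lamhat → ∀ l₁ l₂ : ℕ, 1 ≤ l₁ → l₁ < l₂ →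
      ((l₁ : ℝ) + 1) * θL l₁ lam < ((l₂ : ℝ) + 1) * θL l₂ lam) := by
  have hlamhat_pos : 0 < lamhat := by
    rw [hlamhat]
    exact div_pos (by nlinarith) (hg.trans hgc)
  have hmono : ∀ lam : ℝ, 0 < lam → lam ≤ lamhat → ∀ l₁ l₂ : ℕ, 1 ≤ l₁ → l₁ < l₂ →
      c + (l₁ : ℝ) * (c - lam / 2
          - Real.sqrt (lam^2 / 4 + g^2 * ((l₁ : ℝ) + 1)^2 / (l₁ : ℝ)^2)) <
      c + (l₂ : ℝ) * (c - lam / 2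
          - Real.sqrt (lam^2 / 4 + g^2 * ((l₂ : ℝ) + 1)^2 / (l₂ : ℝ)^2)) :=
    fun lam hlam hle l₁ l₂ h₁ h₁₂ =>
      add_mul_sub_sqrt_lt_add_mul_sub_sqrt hg hgc hlam (hlamhat ▸ hle) (Nat.cast_pos.2 h₁)
        (Nat.cast_lt.2 h₁₂)
  have hroot : ∀ lam : ℝ, 0 < lam → lam < lamhat → ∀ l : ℕ, 1 ≤ l →
      ((l : ℝ) + 1) * θL l lam = c + (l : ℝ) * (c - lam / 2
          - Real.sqrt (lam^2 / 4 + g^2 * ((l : ℝ) + 1)^2 / (l : ℝ)^2)) := by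
    intro lam hlam hlt l hl
    have hl0 : (0 : ℝ) < l := Nat.cast_pos.2 hl
    have hone : 1 ≤ ((l : ℝ) + 1) / l := (one_le_div hl0).2 (by linarith)
    obtain ⟨⟨hθ, hθc⟩, h⟩ :=
      hθL l hl lam hlam (hlt.trans_le (le_mul_of_one_le_left hlamhat_pos.le hone))
    rw [hφ _ hθc, add_sub_cancel_left] at h
    exact add_one_mul_root_eq hg hl0 hθ hθc h
  refine ⟨hmono, fun lam hlam hlt l₁ l₂ h₁ h₁₂ => ?_⟩
  rw [hroot lam hlam hlt l₁ h₁, hroot lam hlam hlt l₂ (h₁.trans h₁₂.le)]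
  exact hmono lam hlam hlt.le l₁ l₂ h₁ h₁₂
end

section
/- (Example 3: constant message lengths, many overheated flows at critical rate.) For each integer l ≥ 1 the equation x = l·(e^{x/(l+1)} − 1) has exactly one root x_l with x_l > 0, and x_l → 2 as l → ∞. (Here x_l equals ϑ_l(λ̂)/c for the constant message-length distribution ξ ≡ 1/c at the critical input rate λ = λ̂ = c.) -/
open Filter Set

/-- The upper Padé bound for the exponential, in a form free of division. -/
lemma two_sub_mul_exp_le {y : ℝ} (h0 : 0 ≤ y) (h2 : y < 2) :
    (2 - y) * Real.exp y ≤ 2 + y := by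
  have hs := Real.hasSum_log_sub_log_of_abs_lt_one (x := y / 2)
    (by rw [abs_lt]; constructor <;> linarith)
  have hle := hs.summable.sum_le_tsum {0} (fun k _ => by positivity)
  rw [hs.tsum_eq] at hle
  simp only [Finset.sum_singleton, Nat.cast_zero] at hle
  have hy : y + Real.log (1 - y / 2) ≤ Real.log (1 + y / 2) := by
    norm_num at hle
    linarith
  have := Real.exp_le_exp.2 hy
  rw [Real.exp_add, Real.exp_log (by linarith), Real.exp_log (by linarith)] at this
  linarith

lemma two_le_of_eq {l x : ℝ} (hl : 0 < l) (hx : 0 < x)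
    (h : x = l * (Real.exp (x / (l + 1)) - 1)) : 2 ≤ x := by
  obtain ⟨y, rfl⟩ : ∃ y, x = (l + 1) * y := ⟨x / (l + 1), by field_simp⟩
  rw [mul_div_cancel_left₀ y (by positivity)] at h
  have hy : 0 < y := pos_of_mul_pos_right hx (by positivity)
  by_contra! hlt
  have hp := two_sub_mul_exp_le hy.le (by nlinarith)
  have hp' : y * (2 - (l + 1) * y) ≤ 0 := by nlinarith
  nlinarith [mul_pos hy (sub_pos.2 hlt)]

lemma le_two_add_of_eq {l x : ℝ} (hl : 0 < l) (hx : 0 < x)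
    (h : x = l * (Real.exp (x / (l + 1)) - 1)) : x ≤ 2 + 2 / l := by
  obtain ⟨y, rfl⟩ : ∃ y, x = (l + 1) * y := ⟨x / (l + 1), by field_simp⟩
  rw [mul_div_cancel_left₀ y (by positivity)] at h
  have hy : 0 < y := pos_of_mul_pos_right hx (by positivity)
  have hq := mul_le_mul_of_nonneg_left (Real.quadratic_le_exp_of_nonneg hy.le) hl.le
  have hly : l * y ≤ 2 := by
    refine le_of_mul_le_mul_right ?_ hy
    linarith
  have hy2 : y ≤ 2 / l := by rw [le_div_iff₀ hl]; linarith
  linarith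

lemma exists_pos_eq {l : ℝ} (hl : 0 < l) :
    ∃ x, 0 < x ∧ x = l * (Real.exp (x / (l + 1)) - 1) := by
  have hab : (2 : ℝ) ≤ 2 + 2 / l := by linarith [div_pos two_pos hl]
  have hc : ContinuousOn (fun x => l * (Real.exp (x / (l + 1)) - 1) - x)
      (Icc 2 (2 + 2 / l)) := by fun_prop
  have ha : l * (Real.exp (2 / (l + 1)) - 1) - 2 ≤ 0 := by
    have hp := two_sub_mul_exp_le (y := 2 / (l + 1)) (by positivity)
      (by rw [div_lt_iff₀ (by positivity)]; linarith)
    have h1 : 2 - 2 / (l + 1) = 2 * l / (l + 1) := by field_simp; ring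
    have h2 : 2 + 2 / (l + 1) = 2 * (l + 2) / (l + 1) := by field_simp; ring
    rw [h1, h2, div_mul_eq_mul_div, div_le_div_iff_of_pos_right (by positivity)] at hp
    linarith
  have hb : 0 ≤ l * (Real.exp ((2 + 2 / l) / (l + 1)) - 1) - (2 + 2 / l) := by
    have h1 : (2 + 2 / l) / (l + 1) = 2 / l := by field_simp
    have hq := Real.quadratic_le_exp_of_nonneg (x := 2 / l) (by positivity)
    have hq' := mul_le_mul_of_nonneg_left hq hl.le
    have h2 : l * (1 + 2 / l + (2 / l) ^ 2 / 2) = l + (2 + 2 / l) := by field_simp; ring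
    rw [h1]
    linarith
  obtain ⟨x, hx, hfx⟩ := intermediate_value_Icc hab hc ⟨ha, hb⟩
  exact ⟨x, by linarith [hx.1], (sub_eq_zero.1 hfx).symm⟩

lemma not_lt_of_eq_of_eq {l x z : ℝ} (hl : 0 < l) (hx : 0 < x)
    (hfx : x = l * (Real.exp (x / (l + 1)) - 1))
    (hfz : z = l * (Real.exp (z / (l + 1)) - 1)) : ¬ x < z := by
  intro hxz
  have hy : 0 < x / (l + 1) := by positivity
  have hw : x / (l + 1) < z / (l + 1) := by gcongr
  have hs := strictConvexOn_exp.secant_strict_mono (mem_univ 0) (mem_univ (x / (l + 1)))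
    (mem_univ (z / (l + 1))) hy.ne' (hy.trans hw).ne' hw
  have slope : ∀ u : ℝ, 0 < u → u = l * (Real.exp (u / (l + 1)) - 1) →
      (Real.exp (u / (l + 1)) - Real.exp 0) / (u / (l + 1) - 0) = (l + 1) / l := by
    intro u hu hfu
    rw [Real.exp_zero, sub_zero, div_eq_div_iff (by positivity) hl.ne', mul_comm _ l, ← hfu]
    field_simp
  rw [slope x hx hfx, slope z (hx.trans hxz) hfz] at hs
  exact hs.false

/-- Example 3: constant message lengths, many overheated flows at
the critical rate: for each l ≥ 1 the equation x = l·(e^{x/(l+1)} − 1) has exactly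
one positive root x_l, and x_l → 2 as l → ∞. -/
theorem stmt_19 :
    (∀ l : ℕ, 1 ≤ l →
      ∃! x : ℝ, 0 < x ∧ x = (l : ℝ) * (Real.exp (x / ((l : ℝ) + 1)) - 1)) ∧
    ∀ x : ℕ → ℝ,
      (∀ l : ℕ, 1 ≤ l →
        0 < x l ∧ x l = (l : ℝ) * (Real.exp (x l / ((l : ℝ) + 1)) - 1)) →
      Filter.Tendsto x Filter.atTop (nhds 2) := by
  refine ⟨fun l hl => ?_, fun x hx => ?_⟩
  · have hl' : (0 : ℝ) < l := by exact_mod_cast hl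
    obtain ⟨x, hx, hfx⟩ := exists_pos_eq hl'
    refine ⟨x, ⟨hx, hfx⟩, fun z hz => le_antisymm ?_ ?_⟩
    · exact not_lt.1 (not_lt_of_eq_of_eq hl' hx hfx hz.2)
    · exact not_lt.1 (not_lt_of_eq_of_eq hl' hz.1 hz.2 hfx)
  · have hlim : Tendsto (fun l : ℕ => 2 + 2 / (l : ℝ)) atTop (nhds 2) := by
      simpa using (tendsto_const_div_atTop_nhds_zero_nat (2 : ℝ)).const_add 2
    refine tendsto_of_tendsto_of_tendsto_of_le_of_le' tendsto_const_nhds hlim ?_ ?_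
    all_goals
      filter_upwards [eventually_ge_atTop 1] with l hl
      have hl' : (0 : ℝ) < l := by exact_mod_cast hl
      obtain ⟨hpos, heq⟩ := hx l hl
    · exact two_le_of_eq hl' hpos heq
    · exact le_two_add_of_eq hl' hpos heq
end
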